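/- Fix β ∈ (−1,1). For every ε > 0 there exist Δ₀ > 0 and x₀ > 0 such that for all α = 2−Δ with 0 < Δ < Δ₀ and all real x with |x| > x₀ one has |f′(x;α,β)/g′(x;α,β) − 1| < ε, where f′ denotes the derivative of f(·;α,β) in x. Moreover, for every δ > 0 there is a function r(Δ) ≥ 0 with r(Δ)/Δ^{δ/2} → 0 as Δ → 0⁺ such that, for all such α and all |x| > x₀: |g′(x;α,β)/F₁′(x;α,β) − 1| ≤ r(Δ) whenever |x−ζ| ≤ (2−δ)·(log(1/Δ))^{1/2}, and |g′(x;α,β)/F₂′(x;α,β) − 1| ≤ r(Δ) whenever |x−ζ| ≥ (2+δ)·(log(1/Δ))^{1/2}. -/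

import Mathlib

open MeasureTheory Filter Set Topology Real

/-- Shift parameter ζ = −β·tan(πα/2) in Zolotarev's (M) parameterization. -/
noncomputable def zetaPar (α β : ℝ) : ℝ := -β * Real.tan (Real.pi * α / 2)

/-- Standard stable density in Zolotarev's (M) parameterization, via the inversion formula. -/
noncomputable def stableDensity (α β x : ℝ) : ℝ :=
  (1 / Real.pi) *
    (∫ t in Set.Ioi (0 : ℝ),
      Complex.exp (-(Complex.I * (t : ℂ) * (x : ℂ))) *
        Complex.exp (-(((t ^ α : ℝ) : ℂ)) *
          (1 + Complex.I * (β : ℂ) * ((Real.tan (Real.pi * α / 2) : ℝ) : ℂ) *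
            (((t ^ (1 - α) : ℝ) : ℂ) - 1)))).re

/-- The N(0,2) density f(y;2). -/
noncomputable def normalDensity (y : ℝ) : ℝ :=
  (1 / (2 * Real.sqrt Real.pi)) * Real.exp (-(y ^ 2) / 4)

/-- F₁(x;α,β) = f(x−ζ;2). -/
noncomputable def F1 (α β x : ℝ) : ℝ := normalDensity (x - zetaPar α β)

/-- F₂(x;α,β) = (1+β*)·Δ·|x−ζ|^{Δ−3} with Δ = 2−α and β* = β·sgn(x−ζ). -/
noncomputable def F2 (α β x : ℝ) : ℝ :=
  (1 + β * Real.sign (x - zetaPar α β)) * (2 - α) * |x - zetaPar α β| ^ ((2 - α) - 3)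

/-- g = F₁ + F₂. -/
noncomputable def gApprox (α β x : ℝ) : ℝ := F1 α β x + F2 α β x

/-- F₁′(x;α,β) = −((x−ζ)/2)·f(x−ζ;2). -/
noncomputable def F1' (α β x : ℝ) : ℝ :=
  -((x - zetaPar α β) / 2) * normalDensity (x - zetaPar α β)

/-- F₂′(x;α,β) = −3(1+β*)·Δ·sgn(x−ζ)·|x−ζ|^{Δ−4}. -/
noncomputable def F2' (α β x : ℝ) : ℝ :=
  -3 * (1 + β * Real.sign (x - zetaPar α β)) * (2 - α) * Real.sign (x - zetaPar α β) *
    |x - zetaPar α β| ^ ((2 - α) - 4)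

/-- g′ = F₁′ + F₂′. -/
noncomputable def gApprox' (α β x : ℝ) : ℝ := F1' α β x + F2' α β x


noncomputable def ccst (Δ β : ℝ) : ℂ := 1 + Complex.I * ((β * Real.tan (Real.pi * Δ / 2) : ℝ) : ℂ)

/-- The integrand of the derivative, as a function of a complex variable. -/
noncomputable def hfun (Δ β y : ℝ) (z : ℂ) : ℂ :=
  z * Complex.exp (-(Complex.I * z * (y : ℂ))) *
    Complex.exp (-(ccst Δ β * z ^ (((2 - Δ : ℝ)) : ℂ)))

/-- The (complex) integral whose imaginary part is the derivative of the density. -/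
noncomputable def Jint (Δ β y : ℝ) : ℂ := ∫ t in Set.Ioi (0 : ℝ), hfun Δ β y (t : ℂ)

lemma tan_small {Δ : ℝ} (h0 : 0 ≤ Δ) (h1 : Δ ≤ 1 / 100) :
    0 ≤ Real.tan (Real.pi * Δ / 2) ∧ Real.tan (Real.pi * Δ / 2) ≤ 4 * Δ := by
  have hp := Real.pi_pos
  have hp4 := Real.pi_lt_four
  have hx0 : 0 ≤ Real.pi * Δ / 2 := by positivity
  have hx1 : Real.pi * Δ / 2 ≤ 2 * Δ := by nlinarith
  have hc : 1 / 2 ≤ Real.cos (Real.pi * Δ / 2) := by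
    have := Real.one_sub_sq_div_two_le_cos (x := Real.pi * Δ / 2)
    nlinarith
  have hs := Real.sin_le hx0
  have hs0 : 0 ≤ Real.sin (Real.pi * Δ / 2) :=
    Real.sin_nonneg_of_nonneg_of_le_pi hx0 (by nlinarith)
  rw [Real.tan_eq_sin_div_cos]
  refine ⟨by positivity, ?_⟩
  rw [div_le_iff₀ (by linarith)]
  nlinarith

lemma ccst_re (Δ β : ℝ) : (ccst Δ β).re = 1 := by
  simp [ccst, -Complex.ofReal_tan, -Complex.ofReal_mul]
lemma ccst_im (Δ β : ℝ) : (ccst Δ β).im = β * Real.tan (Real.pi * Δ / 2) := by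
  simp [ccst, -Complex.ofReal_tan, -Complex.ofReal_mul]

lemma abs_bt {Δ β : ℝ} (h0 : 0 ≤ Δ) (h1 : Δ ≤ 1 / 100) (hb : |β| ≤ 1) :
    |β * Real.tan (Real.pi * Δ / 2)| ≤ 4 * Δ := by
  obtain ⟨ha, hb'⟩ := tan_small h0 h1
  rw [abs_mul, abs_of_nonneg ha]
  nlinarith [abs_nonneg β]

lemma ccst_zero (β : ℝ) : ccst 0 β = 1 := by simp [ccst]

lemma norm_lower {u s : ℝ} (hu : 0 ≤ u) : u ≤ ‖(u : ℂ) - s * Complex.I‖ := by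
  have := Complex.abs_re_le_norm ((u : ℂ) - s * Complex.I)
  simp at this
  rwa [abs_of_nonneg hu] at this

lemma norm_lower' {u s : ℝ} (hs : 0 ≤ s) : s ≤ ‖(u : ℂ) - s * Complex.I‖ := by
  have := Complex.abs_im_le_norm ((u : ℂ) - s * Complex.I)
  simp at this
  rwa [abs_of_nonneg hs] at this

lemma norm_upper {u s : ℝ} (hu : 0 ≤ u) (hs : 0 ≤ s) : ‖(u : ℂ) - s * Complex.I‖ ≤ u + s := by
  refine (norm_sub_le _ _).trans ?_
  simp [abs_of_nonneg hu, abs_of_nonneg hs]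

/-- Lower bound for the real part of the exponent far to the right. -/
lemma re_lower {Δ β u s : ℝ} (h0 : 0 ≤ Δ) (h1 : Δ ≤ 1 / 100) (hb : |β| ≤ 1)
    (hs : 0 ≤ s) (hsu : 4 * s ≤ u) (hu : 1 ≤ u) :
    u / 2 ≤ (ccst Δ β * ((u : ℂ) - s * Complex.I) ^ (((2 - Δ : ℝ)) : ℂ)).re := by
  set z : ℂ := (u : ℂ) - s * Complex.I with hz
  have hzu : u ≤ ‖z‖ := norm_lower (by linarith)
  have hzre : z.re = u := by simp [hz]
  have hzim : z.im = -s := by simp [hz]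
  rw [Complex.mul_re, Complex.cpow_ofReal_re, Complex.cpow_ofReal_im, ccst_re, ccst_im]
  have harg : |z.arg| ≤ 2 / 5 := by
    have h2 : |z.arg| ≤ Real.pi / 2 := Complex.abs_arg_le_pi_div_two_iff.2 (by rw [hzre]; linarith)
    have h3 := Real.mul_abs_le_abs_sin h2
    rw [Complex.sin_arg, hzim, abs_div, abs_neg, abs_of_nonneg hs, abs_of_nonneg (norm_nonneg z)] at h3
    have h4 : s / ‖z‖ ≤ 1 / 4 := by
      rw [div_le_iff₀ (by linarith)]; linarith
    have h5 : 2 / Real.pi * |z.arg| ≤ 1 / 4 := h3.trans h4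
    rw [div_mul_eq_mul_div, div_le_iff₀ Real.pi_pos] at h5
    nlinarith [Real.pi_lt_d2]
  have hang : |z.arg * (2 - Δ)| ≤ 4 / 5 := by
    rw [abs_mul, abs_of_nonneg (by linarith : (0:ℝ) ≤ 2 - Δ)]
    nlinarith [abs_nonneg z.arg]
  have hcos : 0.68 ≤ Real.cos (z.arg * (2 - Δ)) := by
    have := Real.one_sub_sq_div_two_le_cos (x := z.arg * (2 - Δ))
    have h6 := sq_abs (z.arg * (2 - Δ))
    nlinarith [abs_nonneg (z.arg * (2 - Δ))]
  have hbt := abs_bt h0 h1 hb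
  have hsin := Real.abs_sin_le_one (z.arg * (2 - Δ))
  have hprod : β * Real.tan (Real.pi * Δ / 2) * Real.sin (z.arg * (2 - Δ)) ≤ 0.04 := by
    refine (le_abs_self _).trans ?_
    rw [abs_mul]
    nlinarith [abs_nonneg (β * Real.tan (Real.pi * Δ / 2)), abs_nonneg (Real.sin (z.arg * (2 - Δ)))]
  have hr : ‖z‖ ≤ ‖z‖ ^ (2 - Δ) := by
    conv_lhs => rw [← Real.rpow_one ‖z‖]
    exact Real.rpow_le_rpow_of_exponent_le (by linarith) (by linarith)
  nlinarith

lemma norm_exp_sub_one_le_two {w : ℂ} (hw : w.re ≤ 0) : ‖Complex.exp w - 1‖ ≤ 2 * ‖w‖ := by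
  rcases le_or_gt ‖w‖ 1 with h | h
  · exact Complex.norm_exp_sub_one_le h
  · have : ‖Complex.exp w‖ ≤ 1 := by rw [Complex.norm_exp]; exact Real.exp_le_one_iff.2 hw
    calc ‖Complex.exp w - 1‖ ≤ ‖Complex.exp w‖ + ‖(1:ℂ)‖ := norm_sub_le _ _
      _ ≤ 2 * ‖w‖ := by rw [norm_one]; linarith

/-- The exponent is close to that of the Gaussian. -/
lemma exponent_close {Δ β : ℝ} (h0 : 0 ≤ Δ) (h1 : Δ ≤ 1 / 100) (hb : |β| ≤ 1)
    {z : ℂ} (hz1 : 1 ≤ ‖z‖) :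
    ‖z ^ 2 - ccst Δ β * z ^ (((2 - Δ : ℝ)) : ℂ)‖ ≤ 40 * Δ * ‖z‖ ^ 3 := by
  have hz0 : z ≠ 0 := by intro h; simp [h] at hz1; linarith
  have hpow : z ^ (((2 - Δ : ℝ)) : ℂ) = z ^ 2 * Complex.exp (-(Δ * Complex.log z)) := by
    have : (((2 - Δ : ℝ)) : ℂ) = (2 : ℂ) + (-(Δ : ℂ)) := by push_cast; ring
    rw [this, Complex.cpow_add _ _ hz0, Complex.cpow_def_of_ne_zero hz0 (-(Δ:ℂ))]
    congr 1
    · exact_mod_cast Complex.cpow_natCast z 2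
    · congr 1; ring
  have hfac : z ^ 2 - ccst Δ β * z ^ (((2 - Δ : ℝ)) : ℂ) =
      z ^ 2 * ((1 - ccst Δ β) - ccst Δ β * (Complex.exp (-(Δ * Complex.log z)) - 1)) := by
    rw [hpow]; ring
  have hlog : ‖Complex.log z‖ ≤ ‖z‖ + 4 := by
    refine (Complex.norm_le_abs_re_add_abs_im _).trans ?_
    rw [Complex.log_re, Complex.log_im]
    have h3 := Complex.abs_arg_le_pi z
    have h4 := Real.log_le_self (norm_nonneg z)
    rw [abs_of_nonneg (Real.log_nonneg hz1)]
    linarith [Real.pi_lt_four]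
  have hre : (-(Δ * Complex.log z)).re ≤ 0 := by
    simp [Complex.log_re]
    exact mul_nonneg h0 (Real.log_nonneg hz1)
  have he := norm_exp_sub_one_le_two hre
  have hn : ‖-(Δ * Complex.log z)‖ ≤ Δ * (‖z‖ + 4) := by
    rw [norm_neg, norm_mul, Complex.norm_real, Real.norm_of_nonneg h0]
    gcongr
  have hc1 : ‖1 - ccst Δ β‖ ≤ 4 * Δ := by
    have : 1 - ccst Δ β = -(Complex.I * ((β * Real.tan (Real.pi * Δ / 2) : ℝ) : ℂ)) := by
      simp only [ccst]; ring
    rw [this, norm_neg, norm_mul, Complex.norm_I, one_mul, Complex.norm_real]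
    exact abs_bt h0 h1 hb
  have hc2 : ‖ccst Δ β‖ ≤ 2 := by
    have : ccst Δ β = 1 - (1 - ccst Δ β) := by ring
    rw [this]
    refine (norm_sub_le _ _).trans ?_
    rw [norm_one]; linarith
  rw [hfac, norm_mul, norm_pow]
  have hfin : ‖(1 - ccst Δ β) - ccst Δ β * (Complex.exp (-(Δ * Complex.log z)) - 1)‖ ≤ 40 * Δ * ‖z‖ := by
    calc _ ≤ ‖1 - ccst Δ β‖ + ‖ccst Δ β * (Complex.exp (-(Δ * Complex.log z)) - 1)‖ := norm_sub_le _ _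
      _ ≤ 4 * Δ + 2 * (2 * (Δ * (‖z‖ + 4))) := by
        rw [norm_mul]
        gcongr
        exact he.trans (by gcongr)
      _ ≤ _ := by nlinarith
  calc ‖z‖ ^ 2 * _ ≤ ‖z‖ ^ 2 * (40 * Δ * ‖z‖) := by gcongr
    _ = _ := by ring

lemma hfun_continuousAt (Δ β y : ℝ) (h1 : Δ ≤ 1 / 100) {z : ℂ} (hz : 0 ≤ z.re) :
    ContinuousAt (hfun Δ β y) z := by
  have hp : ContinuousAt (fun z : ℂ => z ^ (((2 - Δ : ℝ)) : ℂ)) z :=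
    Complex.continuousAt_cpow_const_of_re_pos (Or.inl hz) (by
      rw [Complex.ofReal_re]; linarith)
  unfold hfun
  fun_prop

lemma hfun_differentiableAt (Δ β y : ℝ) {z : ℂ} (hz : 0 < z.re) :
    DifferentiableAt ℂ (hfun Δ β y) z := by
  have hp : DifferentiableAt ℂ (fun z : ℂ => z ^ (((2 - Δ : ℝ)) : ℂ)) z :=
    DifferentiableAt.cpow_const differentiableAt_id (Or.inl hz)
  unfold hfun
  fun_prop

lemma hfun_norm (Δ β y u s : ℝ) : ‖hfun Δ β y ((u : ℂ) - s * Complex.I)‖ =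
    ‖(u : ℂ) - s * Complex.I‖ * Real.exp (-(s * y)) *
      Real.exp (-(ccst Δ β * ((u : ℂ) - s * Complex.I) ^ (((2 - Δ : ℝ)) : ℂ)).re) := by
  unfold hfun
  rw [norm_mul, norm_mul, Complex.norm_exp, Complex.norm_exp]
  congr 3
  simp

lemma hfun_norm_le {Δ β y u s : ℝ} (h0 : 0 ≤ Δ) (h1 : Δ ≤ 1 / 100) (hb : |β| ≤ 1) (hy : 0 ≤ y)
    (hs : 0 ≤ s) (hsu : 4 * s ≤ u) (hu : 1 ≤ u) :
    ‖hfun Δ β y ((u : ℂ) - s * Complex.I)‖ ≤ 16 * Real.exp (-(1 / 4) * u) := by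
  rw [hfun_norm]
  have hre := re_lower h0 h1 hb hs hsu hu
  have hn : ‖(u : ℂ) - s * Complex.I‖ ≤ 2 * u := (norm_upper (by linarith) hs).trans (by linarith)
  have he : Real.exp (-(s * y)) ≤ 1 := Real.exp_le_one_iff.2 (by nlinarith)
  have h4 : u ≤ 4 * Real.exp (u / 4) := by
    have := Real.add_one_le_exp (u / 4); linarith
  calc _ ≤ (2 * u) * 1 * Real.exp (-(u / 2)) := by
        gcongr
    _ ≤ (2 * (4 * Real.exp (u / 4))) * 1 * Real.exp (-(u / 2)) := by gcongr
    _ = 8 * (Real.exp (u / 4) * Real.exp (-(u / 2))) := by ring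
    _ = 8 * Real.exp (-(1 / 4) * u) := by rw [← Real.exp_add]; congr 2; ring
    _ ≤ _ := by linarith [Real.exp_pos (-(1 / 4) * u)]

lemma hfun_integrableOn {Δ β y s : ℝ} (h0 : 0 ≤ Δ) (h1 : Δ ≤ 1 / 100) (hb : |β| ≤ 1) (hy : 0 ≤ y)
    (hs : 0 ≤ s) : IntegrableOn (fun u : ℝ => hfun Δ β y ((u : ℂ) - s * Complex.I)) (Ioi 0) := by
  have hcont : ContinuousOn (fun u : ℝ => hfun Δ β y ((u : ℂ) - s * Complex.I)) (Ici 0) := by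
    intro u hu
    refine ContinuousAt.continuousWithinAt ?_
    refine ContinuousAt.comp (f := fun u : ℝ => (u : ℂ) - s * Complex.I) (g := hfun Δ β y) ?_ ?_
    · apply hfun_continuousAt _ _ _ h1
      simpa using hu
    · fun_prop
  have hO : (fun u : ℝ => hfun Δ β y ((u : ℂ) - s * Complex.I)) =O[atTop]
      fun u => Real.exp (-(1 / 4) * u) := by
    refine Asymptotics.IsBigO.of_bound 16 ?_
    filter_upwards [eventually_ge_atTop (4 * s), eventually_ge_atTop 1] with u hu hu1
    refine (hfun_norm_le h0 h1 hb hy hs hu hu1).trans ?_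
    rw [Real.norm_of_nonneg (Real.exp_pos _).le]
  exact integrableOn_Ici_iff_integrableOn_Ioi (by finiteness) |>.mp <|
    (hcont.locallyIntegrableOn measurableSet_Ici).integrableOn_of_isBigO_atTop hO
      ⟨Ioi (1 / 4), Ioi_mem_atTop _, exp_neg_integrableOn_Ioi (1 / 4) (by norm_num)⟩

lemma hfun_contour {Δ β y S : ℝ} (h0 : 0 ≤ Δ) (h1 : Δ ≤ 1 / 100) (hb : |β| ≤ 1) (hy : 0 ≤ y)
    (hS : 0 ≤ S) :
    Jint Δ β y = (∫ u in Ioi (0 : ℝ), hfun Δ β y ((u : ℂ) - S * Complex.I)) -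
      ∫ s in (0 : ℝ)..S, (s : ℂ) * Complex.exp (-(s * y)) *
        Complex.exp (-(ccst Δ β * (-(s * Complex.I)) ^ (((2 - Δ : ℝ)) : ℂ))) := by
  have key : ∀ R : ℝ, 0 < R →
      (∫ t in (0 : ℝ)..R, hfun Δ β y (t : ℂ)) =
      (∫ t in (0 : ℝ)..R, hfun Δ β y ((t : ℂ) - S * Complex.I)) -
      (∫ s in (0 : ℝ)..S, (s : ℂ) * Complex.exp (-(s * y)) *
        Complex.exp (-(ccst Δ β * (-(s * Complex.I)) ^ (((2 - Δ : ℝ)) : ℂ)))) +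
      Complex.I * ∫ s in (0 : ℝ)..S, hfun Δ β y ((R : ℂ) - s * Complex.I) := by
    intro R hR
    have hrect := Complex.integral_boundary_rect_eq_zero_of_continuousOn_of_differentiableOn
      (hfun Δ β y) (-(S * Complex.I)) (R : ℂ) ?_ ?_
    · simp only [Complex.neg_re, Complex.mul_re, Complex.ofReal_re, Complex.I_re, mul_zero,
        Complex.ofReal_im, Complex.I_im, mul_one, sub_self, neg_zero, Complex.neg_im,
        Complex.mul_im, add_zero, Complex.ofReal_zero, zero_mul, smul_eq_mul, zero_add] at hrect
      have e1 : ∀ F : ℝ → ℂ, (∫ s in (-S)..0, F s) = ∫ s in (0 : ℝ)..S, F (-s) := by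
        intro F
        rw [intervalIntegral.integral_comp_neg F, neg_zero]
      rw [e1, e1] at hrect
      have e2 : (∫ s in (0 : ℝ)..S, (s : ℂ) * Complex.exp (-(s * y)) *
          Complex.exp (-(ccst Δ β * (-(s * Complex.I)) ^ (((2 - Δ : ℝ)) : ℂ)))) =
          Complex.I * ∫ s in (0 : ℝ)..S, hfun Δ β y (((-s : ℝ) : ℂ) * Complex.I) := by
        rw [← intervalIntegral.integral_const_mul]
        refine intervalIntegral.integral_congr fun s _ => ?_
        simp only [hfun]
        have a1 : ((-s : ℝ) : ℂ) * Complex.I = -(s * Complex.I) := by push_cast; ring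
        rw [a1]
        have a2 : -(Complex.I * -(s * Complex.I) * (y : ℂ)) = -(s * y) := by
          linear_combination (s * y : ℂ) * Complex.I_mul_I
        rw [a2]
        linear_combination ((s : ℂ) * Complex.exp (-(s * y)) *
          Complex.exp (-(ccst Δ β * (-(s * Complex.I)) ^ (((2 - Δ : ℝ)) : ℂ)))) * Complex.I_mul_I
      rw [e2]
      have e3 : ∀ a s : ℝ, (a : ℂ) + ((-s : ℝ) : ℂ) * Complex.I = (a : ℂ) - s * Complex.I := by
        intro a s; push_cast; ring
      simp only [e3] at hrect
      linear_combination -hrect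
    · intro z hz
      refine (hfun_continuousAt _ _ _ h1 ?_).continuousWithinAt
      have := hz.1
      simp [uIcc_of_le hR.le] at this
      exact this.1
    · intro z hz
      refine (hfun_differentiableAt _ _ _ ?_).differentiableWithinAt
      have := hz.1
      simp [hR.le] at this
      exact this.1
  have int0 : IntegrableOn (fun u : ℝ => hfun Δ β y (u : ℂ)) (Ioi 0) := by
    simpa using hfun_integrableOn (s := 0) h0 h1 hb hy le_rfl
  have t1 := intervalIntegral_tendsto_integral_Ioi (0 : ℝ) int0 tendsto_id
  have t2 := intervalIntegral_tendsto_integral_Ioi (0 : ℝ)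
    (hfun_integrableOn (s := S) h0 h1 hb hy hS) tendsto_id
  have t3 : Tendsto (fun R : ℝ => ∫ s in (0 : ℝ)..S, hfun Δ β y ((R : ℂ) - s * Complex.I))
      atTop (𝓝 0) := by
    have tb : Tendsto (fun R : ℝ => 16 * Real.exp (-(1 / 4) * R) * |S - 0|) atTop (𝓝 0) := by
      have : Tendsto (fun R : ℝ => Real.exp (-(1 / 4) * R)) atTop (𝓝 0) := by
        refine Real.tendsto_exp_atBot.comp ?_
        exact tendsto_id.const_mul_atTop_of_neg (by norm_num)
      simpa using (this.const_mul 16).mul_const |S - 0|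
    refine squeeze_zero_norm' ?_ tb
    filter_upwards [eventually_ge_atTop (4 * S), eventually_ge_atTop 1] with R hR hR1
    refine intervalIntegral.norm_integral_le_of_norm_le_const fun s hs => ?_
    rw [uIoc_of_le hS] at hs
    exact hfun_norm_le h0 h1 hb hy hs.1.le (by linarith [hs.2]) hR1
  have t4 := (t2.sub_const (∫ s in (0 : ℝ)..S, (s : ℂ) * Complex.exp (-(s * y)) *
        Complex.exp (-(ccst Δ β * (-(s * Complex.I)) ^ (((2 - Δ : ℝ)) : ℂ))))).add
        (t3.const_mul Complex.I)
  rw [mul_zero, add_zero] at t4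
  refine tendsto_nhds_unique t1 (t4.congr' ?_)
  filter_upwards [eventually_gt_atTop 0] with R hR
  exact (key R hR).symm

/-- Real part coefficient on the vertical segment. -/
noncomputable def aco (Δ β : ℝ) : ℝ :=
  Real.cos (Real.pi * Δ / 2) - β * Real.tan (Real.pi * Δ / 2) * Real.sin (Real.pi * Δ / 2)

/-- Imaginary part coefficient on the vertical segment. -/
noncomputable def bco (Δ β : ℝ) : ℝ := (1 + β) * Real.sin (Real.pi * Δ / 2)

lemma vert_pointwise {Δ β y s : ℝ} (h0 : 0 ≤ Δ) (h1 : Δ ≤ 1 / 100) (hs : 0 ≤ s) :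
    ((s : ℂ) * Complex.exp (-(s * y)) *
        Complex.exp (-(ccst Δ β * (-(s * Complex.I)) ^ (((2 - Δ : ℝ)) : ℂ)))).im =
    s * Real.exp (-(s * y)) * (Real.exp (aco Δ β * s ^ (2 - Δ)) *
      Real.sin (bco Δ β * s ^ (2 - Δ))) := by
  rcases hs.eq_or_lt with rfl | hs
  · simp
  have harg : Complex.arg (-(s * Complex.I)) = -(Real.pi / 2) := by
    have : (-(s * Complex.I) : ℂ) = (s : ℂ) * (-Complex.I) := by ring
    rw [this, Complex.arg_real_mul _ hs, Complex.arg_neg_I]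
  have hnorm : ‖(-(s * Complex.I) : ℂ)‖ = s := by simp [hs.le]
  have hcosne : Real.cos (Real.pi * Δ / 2) ≠ 0 := by
    have := Real.one_sub_sq_div_two_le_cos (x := Real.pi * Δ / 2)
    have hp4 := Real.pi_lt_four
    have hp := Real.pi_pos
    have hx1 : Real.pi * Δ / 2 ≤ 2 * Δ := by nlinarith
    have hx0 : 0 ≤ Real.pi * Δ / 2 := by positivity
    have : 0 < Real.cos (Real.pi * Δ / 2) := by nlinarith
    exact this.ne'
  have hang : -(Real.pi / 2) * (2 - Δ) = Real.pi * Δ / 2 - Real.pi := by ring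
  have hre : ((-(s * Complex.I) : ℂ) ^ (((2 - Δ : ℝ)) : ℂ)).re =
      -(s ^ (2 - Δ) * Real.cos (Real.pi * Δ / 2)) := by
    rw [Complex.cpow_ofReal_re, harg, hnorm, hang, Real.cos_sub_pi]; ring
  have him : ((-(s * Complex.I) : ℂ) ^ (((2 - Δ : ℝ)) : ℂ)).im =
      -(s ^ (2 - Δ) * Real.sin (Real.pi * Δ / 2)) := by
    rw [Complex.cpow_ofReal_im, harg, hnorm, hang, Real.sin_sub_pi]; ring
  have e1 : (s : ℂ) * Complex.exp (-(s * y)) = ((s * Real.exp (-(s * y)) : ℝ) : ℂ) := by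
    push_cast; rfl
  rw [e1, Complex.im_ofReal_mul, Complex.exp_im, Complex.neg_re, Complex.neg_im,
    Complex.mul_re, Complex.mul_im, hre, him, ccst_re, ccst_im]
  congr 3
  · simp only [aco]; ring_nf
  · simp only [bco]
    have ht := Real.tan_mul_cos hcosne
    linear_combination (β * s ^ (2 - Δ)) * ht

lemma vert_cont (Δ β y S : ℝ) (h1 : Δ ≤ 1 / 100) :
    IntervalIntegrable (fun s : ℝ => (s : ℂ) * Complex.exp (-(s * y)) *
        Complex.exp (-(ccst Δ β * (-(s * Complex.I)) ^ (((2 - Δ : ℝ)) : ℂ)))) volume 0 S := by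
  apply Continuous.intervalIntegrable
  rw [continuous_iff_continuousAt]
  intro s
  have hp : ContinuousAt (fun s : ℝ => (-(s * Complex.I) : ℂ) ^ (((2 - Δ : ℝ)) : ℂ)) s := by
    refine ContinuousAt.comp (f := fun s : ℝ => (-(s * Complex.I) : ℂ))
      (g := fun z : ℂ => z ^ (((2 - Δ : ℝ)) : ℂ)) ?_ ?_
    · exact Complex.continuousAt_cpow_const_of_re_pos (Or.inl (by simp)) (by
        rw [Complex.ofReal_re]; linarith)
    · fun_prop
  fun_prop

lemma vert_im {Δ β y S : ℝ} (h0 : 0 ≤ Δ) (h1 : Δ ≤ 1 / 100) (hS : 0 ≤ S) :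
    (∫ s in (0 : ℝ)..S, (s : ℂ) * Complex.exp (-(s * y)) *
        Complex.exp (-(ccst Δ β * (-(s * Complex.I)) ^ (((2 - Δ : ℝ)) : ℂ)))).im =
    ∫ s in (0 : ℝ)..S, s * Real.exp (-(s * y)) * (Real.exp (aco Δ β * s ^ (2 - Δ)) *
      Real.sin (bco Δ β * s ^ (2 - Δ))) := by
  have := Complex.imCLM.intervalIntegral_comp_comm (vert_cont Δ β y S h1)
  simp only [Complex.imCLM_apply] at this
  rw [← this]
  refine intervalIntegral.integral_congr fun s hs => ?_
  rw [uIcc_of_le hS] at hs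
  exact vert_pointwise h0 h1 hs.1

lemma hfun_zero (β y : ℝ) (z : ℂ) : hfun 0 β y z =
    z * Complex.exp (-(Complex.I * z * (y : ℂ))) * Complex.exp (-z ^ 2) := by
  have : z ^ (((2 - 0 : ℝ)) : ℂ) = z ^ 2 := by
    rw [sub_zero, Complex.ofReal_ofNat]
    exact_mod_cast Complex.cpow_natCast z 2
  rw [hfun, ccst_zero, this, one_mul]

lemma bco_zero (β : ℝ) : bco 0 β = 0 := by simp [bco]

/-- At `Δ = 0` we get the Gaussian derivative. -/
lemma Jint_zero {β y : ℝ} (hb : |β| ≤ 1) (hy : 0 ≤ y) :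
    (1 / Real.pi) * (Jint 0 β y).im = -(y / 2) * normalDensity y := by
  have hS : 0 ≤ y / 2 := by linarith
  have hc := hfun_contour (Δ := 0) (S := y / 2) le_rfl (by norm_num) hb hy hS
  have hintg := hfun_integrableOn (Δ := 0) (s := y / 2) le_rfl (by norm_num) hb hy hS
  rw [hc, Complex.sub_im, vert_im le_rfl (by norm_num) hS, bco_zero]
  simp only [zero_mul, Real.sin_zero, mul_zero, intervalIntegral.integral_zero, sub_zero]
  have him := (Complex.imCLM.integral_comp_comm hintg)
  simp only [Complex.imCLM_apply] at him
  rw [← him]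
  have hpt : ∀ u : ℝ, (hfun 0 β y ((u : ℂ) - (y / 2 : ℝ) * Complex.I)).im =
      -(y / 2) * Real.exp (-(y ^ 2) / 4) * Real.exp (-1 * u ^ 2) := by
    intro u
    rw [hfun_zero, mul_assoc, ← Complex.exp_add]
    have : -(Complex.I * ((u : ℂ) - (y / 2 : ℝ) * Complex.I) * (y : ℂ)) +
        -((u : ℂ) - (y / 2 : ℝ) * Complex.I) ^ 2 = ((-(y ^ 2) / 4 + -1 * u ^ 2 : ℝ) : ℂ) := by
      push_cast
      linear_combination ((y : ℂ) ^ 2 / 4) * Complex.I_mul_I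
    rw [this, ← Complex.ofReal_exp, Complex.im_mul_ofReal, Real.exp_add]
    simp
    ring
  simp only [hpt]
  rw [MeasureTheory.integral_const_mul, integral_gaussian_Ioi, div_one, normalDensity]
  have hp := Real.sq_sqrt Real.pi_pos.le
  have hp0 : Real.sqrt Real.pi ≠ 0 := (Real.sqrt_pos.2 Real.pi_pos).ne'
  field_simp
  rw [hp]
  ring

lemma horiz_pointwise {Δ β y L S u : ℝ} (h0 : 0 ≤ Δ) (h1 : Δ ≤ 1 / 100) (hL : 4 ≤ L)
    (hΔ : Δ * L ^ 12 = 1) (hb : |β| ≤ 1) (hS1 : 1 ≤ S) (hSL : S ≤ L) (hu : 0 < u) :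
    ‖hfun Δ β y ((u : ℂ) - S * Complex.I) - hfun 0 β y ((u : ℂ) - S * Complex.I)‖ ≤
      (16 / L ^ 2 * (Real.exp (-(S * y)) * Real.exp (S ^ 2) * (S + 1))) *
        ((1 + u) * Real.exp (-(1 / 4) * u)) := by
  have hL0 : 0 < L := by linarith
  have hzn : ‖(u : ℂ) - S * Complex.I‖ ≤ (S + 1) * (1 + u) :=
    (norm_upper hu.le (by linarith)).trans (by nlinarith)
  have hz1 : 1 ≤ ‖(u : ℂ) - S * Complex.I‖ := hS1.trans (norm_lower' (by linarith))
  have hgre : (-((u : ℂ) - S * Complex.I) ^ 2).re = S ^ 2 - u ^ 2 := by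
    simp [pow_two]
  have heu : Real.exp (-(u ^ 2)) ≤ 2 * Real.exp (-(1 / 4) * u) := by
    have h2 : Real.exp (-(u ^ 2)) ≤ Real.exp (1 / 2) * Real.exp (-(1 / 4) * u) := by
      rw [← Real.exp_add]
      apply Real.exp_le_exp.2
      nlinarith [sq_nonneg (u - 1 / 8)]
    have h3 : Real.exp (1 / 2) ≤ 2 := by
      have h4 : Real.exp (1 / 2) ^ 2 ≤ 2 ^ 2 := by
        rw [← Real.exp_nat_mul]
        norm_num
        linarith [Real.exp_one_lt_d9]
      exact (sq_le_sq₀ (Real.exp_pos _).le (by norm_num)).1 h4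
    exact h2.trans (by gcongr)
  set M : ℝ := Real.exp (-(S * y)) with hM
  have hM0 : 0 < M := Real.exp_pos _
  rcases le_total u (L ^ 2) with hu2 | hu2
  · -- near region
    have hw := exponent_close h0 h1 hb hz1
    set z : ℂ := (u : ℂ) - S * Complex.I with hz
    set w : ℂ := z ^ 2 - ccst Δ β * z ^ (((2 - Δ : ℝ)) : ℂ) with hwdef
    have hz2 : ‖z‖ ≤ 2 * L ^ 2 := (norm_upper hu.le (by linarith)).trans (by nlinarith)
    have hw2 : ‖w‖ ≤ 2 / L ^ 2 := by
      refine hw.trans ?_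
      calc 40 * Δ * ‖z‖ ^ 3 ≤ 40 * Δ * (2 * L ^ 2) ^ 3 := by gcongr
        _ = 320 * (Δ * L ^ 6) := by ring
        _ = 320 / L ^ 6 := by
          rw [eq_div_iff (by positivity)]
          linear_combination 320 * hΔ
        _ ≤ 2 / L ^ 2 := by
          rw [div_le_div_iff₀ (by positivity) (by positivity)]
          have : (4:ℝ) ^ 4 ≤ L ^ 4 := by gcongr
          nlinarith [pow_pos hL0 2]
    have hw1 : ‖w‖ ≤ 1 := by
      refine hw2.trans ?_
      rw [div_le_one (by positivity)]; nlinarith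
    have hew : ‖Complex.exp w - 1‖ ≤ 4 / L ^ 2 := by
      refine (Complex.norm_exp_sub_one_le hw1).trans ?_
      calc 2 * ‖w‖ ≤ 2 * (2 / L ^ 2) := by gcongr
        _ = _ := by ring
    have hdec : hfun Δ β y z - hfun 0 β y z =
        z * Complex.exp (-(Complex.I * z * (y : ℂ))) * Complex.exp (-z ^ 2) *
          (Complex.exp w - 1) := by
      rw [hfun_zero, hfun]
      have : Complex.exp (-(ccst Δ β * z ^ (((2 - Δ : ℝ)) : ℂ))) =
          Complex.exp (-z ^ 2) * Complex.exp w := by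
        rw [← Complex.exp_add, hwdef]; congr 1; ring
      rw [this]; ring
    rw [hdec, norm_mul, norm_mul, norm_mul, Complex.norm_exp, Complex.norm_exp, hgre]
    have hre : (-(Complex.I * z * (y : ℂ))).re = -(S * y) := by simp [hz]
    rw [hre, ← hM]
    calc ‖z‖ * M * Real.exp (S ^ 2 - u ^ 2) * ‖Complex.exp w - 1‖
        ≤ ((S + 1) * (1 + u)) * M * (Real.exp (S ^ 2) * (2 * Real.exp (-(1 / 4) * u))) *
          (4 / L ^ 2) := by
          gcongr
          rw [sub_eq_add_neg, Real.exp_add]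
          gcongr
      _ = (8 / L ^ 2 * (M * Real.exp (S ^ 2) * (S + 1))) *
        ((1 + u) * Real.exp (-(1 / 4) * u)) := by ring
      _ ≤ _ := by
        gcongr
        norm_num
  · -- far region
    have h4S : 4 * S ≤ u := by nlinarith
    have hu1 : 1 ≤ u := by linarith
    have hr := re_lower h0 h1 hb (by linarith : (0:ℝ) ≤ S) h4S hu1
    have hsmall : Real.exp (-(u / 4)) ≤ 4 / L ^ 2 := by
      rw [Real.exp_neg, inv_eq_one_div, div_le_div_iff₀ (Real.exp_pos _) (by positivity)]
      have := Real.add_one_le_exp (u / 4)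
      linarith
    have e1 : Real.exp (-(u / 2)) ≤ 4 / L ^ 2 * Real.exp (-(1 / 4) * u) := by
      have : Real.exp (-(u / 2)) = Real.exp (-(u / 4)) * Real.exp (-(1 / 4) * u) := by
        rw [← Real.exp_add]; congr 1; ring
      rw [this]; gcongr
    have hS2 : 1 ≤ Real.exp (S ^ 2) := Real.one_le_exp (by positivity)
    have hA : ‖hfun Δ β y ((u : ℂ) - S * Complex.I)‖ ≤ ((S + 1) * (1 + u)) * M *
        (Real.exp (S ^ 2) * (4 / L ^ 2 * Real.exp (-(1 / 4) * u))) := by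
      rw [hfun_norm]
      gcongr
      calc _ ≤ Real.exp (-(u / 2)) := by
            apply Real.exp_le_exp.2
            linarith
        _ ≤ 1 * (4 / L ^ 2 * Real.exp (-(1 / 4) * u)) := by rw [one_mul]; exact e1
        _ ≤ _ := by gcongr
    have hB : ‖hfun 0 β y ((u : ℂ) - S * Complex.I)‖ ≤ ((S + 1) * (1 + u)) * M *
        (Real.exp (S ^ 2) * (4 / L ^ 2 * Real.exp (-(1 / 4) * u))) := by
      rw [hfun_zero, norm_mul, norm_mul, Complex.norm_exp, Complex.norm_exp, hgre]
      have hre : (-(Complex.I * ((u : ℂ) - S * Complex.I) * (y : ℂ))).re = -(S * y) := by simp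
      rw [hre, ← hM, sub_eq_add_neg (S ^ 2), Real.exp_add]
      gcongr
      refine le_trans ?_ e1
      apply Real.exp_le_exp.2
      nlinarith
    calc _ ≤ _ := norm_sub_le _ _
      _ ≤ _ := add_le_add hA hB
      _ = (8 / L ^ 2 * (M * Real.exp (S ^ 2) * (S + 1))) *
        ((1 + u) * Real.exp (-(1 / 4) * u)) := by ring
      _ ≤ _ := by
        gcongr
        norm_num

lemma kern_integrable : IntegrableOn (fun u : ℝ => (1 + u) * Real.exp (-(1 / 4) * u)) (Ioi 0) := by
  refine integrable_of_isBigO_exp_neg (b := 1 / 8) (by norm_num) (by fun_prop) ?_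
  refine Asymptotics.IsBigO.of_bound 8 ?_
  filter_upwards [eventually_ge_atTop 0] with u hu
  rw [Real.norm_of_nonneg (by positivity), Real.norm_of_nonneg (by positivity)]
  have h1 : 1 + u ≤ 8 * Real.exp (u / 8) := by
    have := Real.add_one_le_exp (u / 8); linarith
  calc (1 + u) * Real.exp (-(1 / 4) * u) ≤ (8 * Real.exp (u / 8)) * Real.exp (-(1 / 4) * u) := by gcongr
    _ = 8 * Real.exp (-(1 / 8) * u) := by rw [mul_assoc, ← Real.exp_add]; congr 2; ring

lemma horiz_bound : ∃ C > (0 : ℝ), ∀ Δ β y L S : ℝ, 0 ≤ Δ → Δ ≤ 1 / 100 → 4 ≤ L → Δ * L ^ 12 = 1 →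
    |β| ≤ 1 → 0 ≤ y → 1 ≤ S → S ≤ L →
    |((∫ u in Ioi (0 : ℝ), hfun Δ β y ((u : ℂ) - S * Complex.I)).im -
      (∫ u in Ioi (0 : ℝ), hfun 0 β y ((u : ℂ) - S * Complex.I)).im)| ≤
      C / L ^ 2 * (Real.exp (-(S * y)) * Real.exp (S ^ 2) * (S + 1)) := by
  set K := ∫ u in Ioi (0 : ℝ), (1 + u) * Real.exp (-(1 / 4) * u) with hK
  have hK0 : 0 ≤ K := by
    refine setIntegral_nonneg measurableSet_Ioi fun u hu => ?_
    have : 0 < u := hu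
    positivity
  refine ⟨16 * K + 1, by linarith, ?_⟩
  intro Δ β y L S h0 h1 hL hΔ hb hy hS1 hSL
  have hS0 : 0 ≤ S := by linarith
  have i1 := hfun_integrableOn (s := S) h0 h1 hb hy hS0
  have i2 := hfun_integrableOn (Δ := 0) (s := S) le_rfl (by norm_num) hb hy hS0
  rw [← Complex.sub_im, ← integral_sub i1 i2]
  refine (Complex.abs_im_le_norm _).trans ?_
  have := norm_integral_le_of_norm_le (μ := volume.restrict (Ioi (0:ℝ)))
    (f := fun u : ℝ => hfun Δ β y ((u : ℂ) - S * Complex.I) - hfun 0 β y ((u : ℂ) - S * Complex.I))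
    (kern_integrable.const_mul (16 / L ^ 2 * (Real.exp (-(S * y)) * Real.exp (S ^ 2) * (S + 1))))
    ((ae_restrict_mem measurableSet_Ioi).mono fun u hu =>
      horiz_pointwise h0 h1 hL hΔ hb hS1 hSL hu)
  refine this.trans ?_
  rw [MeasureTheory.integral_const_mul, ← hK]
  have hX : 0 ≤ (Real.exp (-(S * y)) * Real.exp (S ^ 2) * (S + 1)) / L ^ 2 := by positivity
  calc _ = 16 * K * ((Real.exp (-(S * y)) * Real.exp (S ^ 2) * (S + 1)) / L ^ 2) := by ring
    _ ≤ (16 * K + 1) * ((Real.exp (-(S * y)) * Real.exp (S ^ 2) * (S + 1)) / L ^ 2) := by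
      gcongr; linarith
    _ = _ := by ring

lemma sin_small {Δ : ℝ} (h0 : 0 ≤ Δ) (h1 : Δ ≤ 1 / 100) :
    0 ≤ Real.sin (Real.pi * Δ / 2) ∧ Real.sin (Real.pi * Δ / 2) ≤ 2 * Δ := by
  have hp := Real.pi_pos
  have hp4 := Real.pi_lt_four
  have hx0 : 0 ≤ Real.pi * Δ / 2 := by positivity
  have hx1 : Real.pi * Δ / 2 ≤ 2 * Δ := by nlinarith
  exact ⟨Real.sin_nonneg_of_nonneg_of_le_pi hx0 (by nlinarith), (Real.sin_le hx0).trans hx1⟩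

lemma aco_bounds {Δ β : ℝ} (h0 : 0 ≤ Δ) (h1 : Δ ≤ 1 / 100) (hb : |β| ≤ 1) :
    0 ≤ aco Δ β ∧ aco Δ β ≤ 1 + 4 * Δ := by
  have hp := Real.pi_pos
  have hp4 := Real.pi_lt_four
  have hx0 : 0 ≤ Real.pi * Δ / 2 := by positivity
  have hx1 : Real.pi * Δ / 2 ≤ 2 * Δ := by nlinarith
  have hc := Real.one_sub_sq_div_two_le_cos (x := Real.pi * Δ / 2)
  have hc1 := Real.cos_le_one (Real.pi * Δ / 2)
  obtain ⟨s0, s1⟩ := sin_small h0 h1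
  have hbt := abs_bt h0 h1 hb
  have hm : |β * Real.tan (Real.pi * Δ / 2) * Real.sin (Real.pi * Δ / 2)| ≤ 4 * Δ := by
    rw [abs_mul, abs_of_nonneg s0]
    nlinarith [abs_nonneg (β * Real.tan (Real.pi * Δ / 2))]
  rw [abs_le] at hm
  unfold aco
  constructor <;> nlinarith

lemma bco_bounds {Δ β : ℝ} (h0 : 0 ≤ Δ) (h1 : Δ ≤ 1 / 100) (hb : |β| ≤ 1) :
    0 ≤ bco Δ β ∧ bco Δ β ≤ 4 * Δ := by
  obtain ⟨s0, s1⟩ := sin_small h0 h1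
  rw [abs_le] at hb
  unfold bco
  constructor <;> nlinarith

lemma rpow_le_one_add_sq {Δ s : ℝ} (h0 : 0 ≤ Δ) (h1 : Δ ≤ 1 / 100) (hs : 0 < s) :
    s ^ (2 - Δ) ≤ 1 + s ^ 2 := by
  rcases le_total s 1 with h | h
  · have := Real.rpow_le_one hs.le h (by linarith : (0:ℝ) ≤ 2 - Δ)
    nlinarith [sq_nonneg s]
  · have : s ^ (2 - Δ) ≤ s ^ (2 : ℝ) := Real.rpow_le_rpow_of_exponent_le h (by linarith)
    rw [Real.rpow_two] at this
    linarith

lemma vert_pt_near {Δ β y L s : ℝ} (h0 : 0 ≤ Δ) (h1 : Δ ≤ 1 / 100) (hb : |β| ≤ 1)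
    (hL : 4 ≤ L) (hΔ : Δ * L ^ 12 = 1) (hs : 0 < s) (hsL : s ≤ L) (hsy : s ≤ y / 2) :
    |s * Real.exp (-(s * y)) * (Real.exp (aco Δ β * s ^ (2 - Δ)) * Real.sin (bco Δ β * s ^ (2 - Δ))) -
      bco Δ β * (s ^ (3 - Δ) * Real.exp (-(y * s)))| ≤
      bco Δ β * 81 * (s ^ (5 - 2 * Δ) * Real.exp (-(y / 2 * s))) := by
  obtain ⟨a0, a1⟩ := aco_bounds h0 h1 hb
  obtain ⟨b0, b1⟩ := bco_bounds h0 h1 hb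
  set a := aco Δ β
  set b := bco Δ β
  set p := s ^ (2 - Δ) with hp
  have hp0 : 0 < p := Real.rpow_pos_of_pos hs _
  have hp1 : p ≤ 1 + s ^ 2 := rpow_le_one_add_sq h0 h1 hs
  have hL0 : 0 < L := by linarith
  have hΔL : Δ * (1 + L ^ 2) ≤ 1 / 4 := by
    have e : (1 : ℝ) / 4 = Δ * (L ^ 12 / 4) := by linarith
    rw [e]
    gcongr
    have h4 : (4:ℝ) ^ 10 ≤ L ^ 10 := by gcongr
    have : L ^ 12 = L ^ 10 * L ^ 2 := by ring
    rw [this]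
    nlinarith [sq_nonneg L]
  have hps : p ≤ 1 + L ^ 2 := hp1.trans (by gcongr)
  have hq0 : 0 ≤ b * p := by positivity
  have hq1 : b * p ≤ 1 := by
    calc b * p ≤ (4 * Δ) * (1 + L ^ 2) := by gcongr
      _ ≤ 1 := by linarith
  have hA0 : 0 ≤ a * p := by positivity
  have hA1 : a * p ≤ 3 + s * y / 2 := by
    calc a * p ≤ (1 + 4 * Δ) * p := by gcongr
      _ = p + 4 * (Δ * p) := by ring
      _ ≤ (1 + s ^ 2) + 4 * (Δ * (1 + L ^ 2)) := by gcongr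
      _ ≤ _ := by nlinarith
  have hsin : |Real.sin (b * p) - b * p| ≤ b * p * p := by
    have hup := Real.sin_le hq0
    have hlow : b * p - (b * p) ^ 3 / 6 ≤ Real.sin (b * p) := by
      rcases hq0.eq_or_lt with h | h
      · rw [← h]; simp
      · exact (Real.sin_gt_sub_cube h).le
    rw [abs_sub_comm, abs_of_nonneg (by linarith)]
    have hbb : b ≤ 1 := by linarith
    have : (b * p) ^ 3 ≤ b * p * p := by
      calc (b * p) ^ 3 = (b * p) * ((b * p) * (b * p)) := by ring
        _ ≤ (b * p) * (1 * (1 * p)) := by gcongr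
        _ = _ := by ring
    have : 0 ≤ b * p * p := by positivity
    linarith
  have hexp : Real.exp (a * p) - 1 ≤ 2 * p * Real.exp (a * p) := by
    have h := Real.add_one_le_exp (-(a * p))
    have h' : Real.exp (-(a * p)) * Real.exp (a * p) = 1 := by rw [← Real.exp_add]; simp
    have h2 : a * p ≤ 2 * p := by gcongr; linarith
    nlinarith [Real.exp_pos (a * p)]
  have hexp1 : 1 ≤ Real.exp (a * p) := Real.one_le_exp hA0
  have hsq : |Real.sin (b * p)| ≤ b * p := by
    have := Real.abs_sin_le_abs (x := b * p)
    rwa [abs_of_nonneg hq0] at this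
  have hmain : |Real.exp (a * p) * Real.sin (b * p) - b * p| ≤ b * 3 * (p * p) * Real.exp (a * p) := by
    have e : Real.exp (a * p) * Real.sin (b * p) - b * p =
      (Real.exp (a * p) - 1) * Real.sin (b * p) + (Real.sin (b * p) - b * p) := by ring
    rw [e]
    refine (abs_add_le _ _).trans ?_
    rw [abs_mul, abs_of_nonneg (by linarith : 0 ≤ Real.exp (a * p) - 1)]
    calc _ ≤ (2 * p * Real.exp (a * p)) * (b * p) + b * p * p * 1 := by
          rw [mul_one]
          gcongr
      _ ≤ (2 * p * Real.exp (a * p)) * (b * p) + b * p * p * Real.exp (a * p) := by gcongr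
      _ = _ := by ring
  have e3 : s ^ (3 - Δ) = s * p := by
    rw [hp, show (3 - Δ) = 1 + (2 - Δ) by ring, Real.rpow_add hs, Real.rpow_one]
  have e5 : s ^ (5 - 2 * Δ) = s * (p * p) := by
    rw [hp, show (5 - 2 * Δ) = 1 + ((2 - Δ) + (2 - Δ)) by ring, Real.rpow_add hs, Real.rpow_add hs,
      Real.rpow_one]
  have he : Real.exp (-(s * y)) * Real.exp (a * p) ≤ 27 * Real.exp (-(y / 2 * s)) := by
    have h3 : Real.exp 3 ≤ 27 := by
      have : Real.exp 3 = Real.exp 1 ^ 3 := by rw [← Real.exp_nat_mul]; norm_num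
      rw [this]
      calc Real.exp 1 ^ 3 ≤ 3 ^ 3 := by
            gcongr
            linarith [Real.exp_one_lt_d9]
        _ = 27 := by norm_num
    calc Real.exp (-(s * y)) * Real.exp (a * p) = Real.exp (-(s * y) + a * p) := by rw [Real.exp_add]
      _ ≤ Real.exp (3 + -(y / 2 * s)) := by
        apply Real.exp_le_exp.2; linarith
      _ = Real.exp 3 * Real.exp (-(y / 2 * s)) := by rw [Real.exp_add]
      _ ≤ _ := by gcongr
  have efin : s * Real.exp (-(s * y)) * (Real.exp (a * p) * Real.sin (b * p)) -
      b * (s ^ (3 - Δ) * Real.exp (-(y * s))) =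
      (s * Real.exp (-(s * y))) * (Real.exp (a * p) * Real.sin (b * p) - b * p) := by
    rw [e3, mul_comm y s]; ring
  rw [efin, abs_mul, abs_of_nonneg (by positivity), e5]
  calc _ ≤ (s * Real.exp (-(s * y))) * (b * 3 * (p * p) * Real.exp (a * p)) := by gcongr
    _ = b * 3 * (s * (p * p)) * (Real.exp (-(s * y)) * Real.exp (a * p)) := by ring
    _ ≤ b * 3 * (s * (p * p)) * (27 * Real.exp (-(y / 2 * s))) := by gcongr
    _ = _ := by ring

lemma vert_bound {Δ β y L S : ℝ} (h0 : 0 ≤ Δ) (h1 : Δ ≤ 1 / 100) (hb : |β| ≤ 1)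
    (hL : 4 ≤ L) (hΔ : Δ * L ^ 12 = 1) (hS1 : 1 ≤ S) (hSL : S ≤ L) (hSy : S ≤ y / 2) :
    |(∫ s in (0 : ℝ)..S, s * Real.exp (-(s * y)) * (Real.exp (aco Δ β * s ^ (2 - Δ)) *
      Real.sin (bco Δ β * s ^ (2 - Δ)))) - bco Δ β * (y ^ (Δ - 4) * Real.Gamma (4 - Δ))| ≤
      bco Δ β * (81 * 64 * 120) * (y ^ (Δ - 4) / y) := by
  obtain ⟨b0, b1⟩ := bco_bounds h0 h1 hb
  have hy2 : 2 ≤ y := by linarith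
  have hy : 0 < y := by linarith
  have g1 : ∫ s in Ioi (0 : ℝ), s ^ (3 - Δ) * Real.exp (-(y * s)) = y ^ (Δ - 4) * Real.Gamma (4 - Δ) := by
    have := Real.integral_rpow_mul_exp_neg_mul_Ioi (a := 4 - Δ) (r := y) (by linarith) hy
    rw [show 4 - Δ - 1 = 3 - Δ by ring] at this
    rw [this, one_div, Real.inv_rpow hy.le, ← Real.rpow_neg hy.le]
    congr 2; ring
  have g2 : ∫ s in Ioi (0 : ℝ), s ^ (5 - 2 * Δ) * Real.exp (-(y / 2 * s)) =
      (y / 2) ^ (2 * Δ - 6) * Real.Gamma (6 - 2 * Δ) := by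
    have := Real.integral_rpow_mul_exp_neg_mul_Ioi (a := 6 - 2 * Δ) (r := y / 2) (by linarith) (by linarith)
    rw [show 6 - 2 * Δ - 1 = 5 - 2 * Δ by ring] at this
    rw [this, one_div, Real.inv_rpow (by linarith), ← Real.rpow_neg (by linarith)]
    congr 2; ring
  have i1 : IntegrableOn (fun s : ℝ => s ^ (3 - Δ) * Real.exp (-(y * s))) (Ioi 0) := by
    have := integrableOn_rpow_mul_exp_neg_mul_rpow (p := 1) (s := 3 - Δ) (b := y) (by linarith)
      one_pos hy
    simpa using this
  have i2 : IntegrableOn (fun s : ℝ => s ^ (5 - 2 * Δ) * Real.exp (-(y / 2 * s))) (Ioi 0) := by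
    have := integrableOn_rpow_mul_exp_neg_mul_rpow (p := 1) (s := 5 - 2 * Δ) (b := y / 2) (by linarith)
      one_pos (by linarith)
    simpa using this
  set F : ℝ → ℝ := fun s => s * Real.exp (-(s * y)) * (Real.exp (aco Δ β * s ^ (2 - Δ)) *
      Real.sin (bco Δ β * s ^ (2 - Δ))) with hF
  have cF : Continuous F := by
    have : Continuous fun s : ℝ => s ^ (2 - Δ) := Real.continuous_rpow_const (by linarith)
    rw [hF]; fun_prop
  have e1 : (∫ s in (0 : ℝ)..S, F s) = ∫ s in Ioi (0 : ℝ), (Ioc 0 S).indicator F s := by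
    rw [intervalIntegral.integral_of_le (by linarith), setIntegral_indicator measurableSet_Ioc]
    congr 2
    ext s; simp only [mem_inter_iff, mem_Ioi, mem_Ioc]; tauto
  have i3 : IntegrableOn ((Ioc 0 S).indicator F) (Ioi 0) := by
    apply Integrable.integrableOn
    rw [integrable_indicator_iff measurableSet_Ioc]
    exact (cF.integrableOn_Icc).mono_set Ioc_subset_Icc_self
  have hpt : ∀ s ∈ Ioi (0:ℝ), ‖(Ioc 0 S).indicator F s - bco Δ β * (s ^ (3 - Δ) * Real.exp (-(y * s)))‖ ≤
      bco Δ β * 81 * (s ^ (5 - 2 * Δ) * Real.exp (-(y / 2 * s))) := by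
    intro s hs
    have hs0 : 0 < s := hs
    rcases le_or_gt s S with h | h
    · rw [indicator_of_mem (show s ∈ Ioc 0 S from ⟨hs0, h⟩), Real.norm_eq_abs]
      exact vert_pt_near h0 h1 hb hL hΔ hs0 (h.trans hSL) (h.trans hSy)
    · rw [indicator_of_notMem (fun hh : s ∈ Ioc 0 S => absurd hh.2 (not_le.2 h)), zero_sub, norm_neg,
        Real.norm_of_nonneg (by positivity)]
      have hs1 : 1 ≤ s := by linarith
      calc bco Δ β * (s ^ (3 - Δ) * Real.exp (-(y * s)))
          ≤ bco Δ β * (s ^ (5 - 2 * Δ) * Real.exp (-(y / 2 * s))) := by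
            have hr : s ^ (3 - Δ) ≤ s ^ (5 - 2 * Δ) :=
              Real.rpow_le_rpow_of_exponent_le hs1 (by linarith)
            gcongr
            linarith
        _ = bco Δ β * 1 * (s ^ (5 - 2 * Δ) * Real.exp (-(y / 2 * s))) := by ring
        _ ≤ _ := by gcongr; norm_num
  rw [e1, ← g1, ← MeasureTheory.integral_const_mul, ← integral_sub i3 (i1.const_mul _)]
  have := norm_integral_le_of_norm_le (μ := volume.restrict (Ioi (0:ℝ))) (i2.const_mul (bco Δ β * 81))
    ((ae_restrict_mem measurableSet_Ioi).mono hpt)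
  rw [Real.norm_eq_abs] at this
  refine this.trans ?_
  rw [MeasureTheory.integral_const_mul, g2]
  have hG : Real.Gamma (6 - 2 * Δ) ≤ 120 := by
    have h6 : Real.Gamma 6 = 120 := by
      have := Real.Gamma_nat_eq_factorial 5
      rw [show ((5 : ℕ) : ℝ) + 1 = 6 by norm_num] at this
      rw [this]; norm_num [Nat.factorial]
    rw [← h6]
    exact Real.Gamma_strictMonoOn_Ici.monotoneOn (mem_Ici.2 (by linarith))
      (mem_Ici.2 (by norm_num)) (by linarith)
  have hG0 : 0 ≤ Real.Gamma (6 - 2 * Δ) := (Real.Gamma_pos_of_pos (by linarith)).le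
  have hpw : (y / 2) ^ (2 * Δ - 6) ≤ 64 * (y ^ (Δ - 4) / y) := by
    rw [Real.div_rpow hy.le (by norm_num)]
    have h2 : (1 : ℝ) / 64 ≤ 2 ^ (2 * Δ - 6) := by
      have : (2 : ℝ) ^ (-6 : ℝ) ≤ 2 ^ (2 * Δ - 6) :=
        Real.rpow_le_rpow_of_exponent_le (by norm_num) (by linarith)
      rw [Real.rpow_neg (by norm_num)] at this
      norm_num at this ⊢
      exact this
    have h3 : y ^ (2 * Δ - 6) ≤ y ^ (Δ - 4) / y := by
      rw [← Real.rpow_sub_one hy.ne']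
      exact Real.rpow_le_rpow_of_exponent_le (by linarith) (by linarith)
    rw [div_le_iff₀ (by positivity)]
    have h4 : 0 ≤ y ^ (Δ - 4) / y := by positivity
    nlinarith
  calc bco Δ β * 81 * ((y / 2) ^ (2 * Δ - 6) * Real.Gamma (6 - 2 * Δ))
      ≤ bco Δ β * 81 * ((64 * (y ^ (Δ - 4) / y)) * 120) := by gcongr
    _ = _ := by ring

lemma gamma_sin_limit : Tendsto (fun Δ : ℝ => Real.sin (Real.pi * Δ / 2) / (Real.pi * Δ) * Real.Gamma (4 - Δ))
    (𝓝[>] 0) (𝓝 3) := by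
  have hG : Tendsto (fun Δ : ℝ => Real.Gamma (4 - Δ)) (𝓝[>] 0) (𝓝 6) := by
    have h4 : Real.Gamma 4 = 6 := by
      have := Real.Gamma_nat_eq_factorial 3
      rw [show ((3 : ℕ) : ℝ) + 1 = 4 by norm_num] at this
      rw [this]; norm_num [Nat.factorial]
    have hc : ContinuousAt Real.Gamma 4 := (Real.differentiableAt_Gamma fun m => by
      have : (0:ℝ) ≤ m := Nat.cast_nonneg m
      intro h; linarith).continuousAt
    have h2 : Tendsto (fun Δ : ℝ => 4 - Δ) (𝓝[>] 0) (𝓝 4) := by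
      have : Tendsto (fun Δ : ℝ => 4 - Δ) (𝓝 0) (𝓝 (4 - 0)) := by
        apply Continuous.tendsto; fun_prop
      rw [sub_zero] at this
      exact this.mono_left nhdsWithin_le_nhds
    rw [← h4]
    exact hc.tendsto.comp h2
  have hs : Tendsto (fun Δ : ℝ => Real.sin (Real.pi * Δ / 2) / (Real.pi * Δ)) (𝓝[>] 0) (𝓝 (1 / 2)) := by
    have hd : HasDerivAt (fun Δ : ℝ => Real.sin (Real.pi * Δ / 2)) (Real.pi / 2) 0 := by
      have h := ((hasDerivAt_id (0:ℝ)).const_mul Real.pi).div_const 2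
      have h2 := h.sin
      simpa using h2
    have h3 := hd.tendsto_slope
    have h4 : Tendsto (slope (fun Δ : ℝ => Real.sin (Real.pi * Δ / 2)) 0) (𝓝[>] 0) (𝓝 (Real.pi / 2)) :=
      h3.mono_left (nhdsWithin_mono _ fun x hx => ne_of_gt hx)
    have h5 := h4.div_const Real.pi
    have e : Real.pi / 2 / Real.pi = 1 / 2 := by
      field_simp
    rw [e] at h5
    refine h5.congr fun Δ => ?_
    simp [slope_def_field]
    rw [div_div, mul_comm]
  have := hs.mul hG
  norm_num at this
  exact this

set_option maxHeartbeats 2000000 in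
lemma core {β ε : ℝ} (hβ : |β| < 1) (hε : 0 < ε) : ∃ Δ₀ > (0 : ℝ), Δ₀ ≤ 1 / 100 ∧ ∃ Y > (0 : ℝ),
    ∀ Δ : ℝ, 0 < Δ → Δ < Δ₀ → ∀ y : ℝ, Y ≤ y →
      |(1 / Real.pi) * (Jint Δ β y).im -
        (-(y / 2) * normalDensity y + -3 * (1 + β) * Δ * y ^ (Δ - 4))| ≤
      ε * (y / 2 * normalDensity y + 3 * (1 + β) * Δ * y ^ (Δ - 4)) := by
  obtain ⟨C, hC, hH⟩ := horiz_bound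
  have hb1 : 0 < 1 + β := by rw [abs_lt] at hβ; linarith
  have hlim := gamma_sin_limit
  rw [Metric.tendsto_nhdsWithin_nhds] at hlim
  obtain ⟨Δ₁, hΔ₁, hlim⟩ := hlim ε hε
  set K : ℝ := 362880 * 512 with hK
  set M : ℝ := 4 + 8 * C / ε + C * K / (ε * (1 + β)) with hM
  have hM4 : 4 ≤ M := by
    have : 0 ≤ 8 * C / ε := by positivity
    have : 0 ≤ C * K / (ε * (1 + β)) := by positivity
    linarith
  have hM0 : 0 < M := by linarith
  refine ⟨min (1 / M ^ 12) Δ₁, by positivity, ?_, 2 + 4 * (81 * 64 * 120) / (ε * (1 + β)), by positivity, ?_⟩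
  · refine (min_le_left _ _).trans ?_
    apply one_div_le_one_div_of_le (by norm_num)
    calc (100 : ℝ) ≤ 4 ^ 12 := by norm_num
      _ ≤ M ^ 12 := by gcongr
  intro Δ hΔ0 hΔlt y hyY
  have hΔM : Δ < 1 / M ^ 12 := hΔlt.trans_le (min_le_left _ _)
  have hΔ1 : Δ < Δ₁ := hΔlt.trans_le (min_le_right _ _)
  have hΔs : Δ ≤ 1 / 100 := by
    refine hΔM.le.trans ?_
    apply one_div_le_one_div_of_le (by norm_num)
    calc (100 : ℝ) ≤ 4 ^ 12 := by norm_num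
      _ ≤ M ^ 12 := by gcongr
  set L : ℝ := (1 / Δ) ^ ((1 : ℝ) / 12) with hLdef
  have hLpos : 0 < L := by positivity
  have hL12 : L ^ 12 = 1 / Δ := by
    rw [hLdef, ← Real.rpow_natCast, ← Real.rpow_mul (by positivity)]
    norm_num
  have hΔL : Δ * L ^ 12 = 1 := by rw [hL12]; field_simp
  have hML : M < L := by
    apply lt_of_pow_lt_pow_left₀ 12 hLpos.le
    rw [hL12]
    rw [lt_div_iff₀ (by positivity)] at hΔM
    rw [lt_div_iff₀ hΔ0]
    linarith
  have hL4 : 4 ≤ L := by linarith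
  have hy2 : 2 ≤ y := by
    have : 0 ≤ 4 * (81 * 64 * 120) / (ε * (1 + β)) := by positivity
    linarith
  have hy0 : 0 < y := by linarith
  set S : ℝ := min (y / 2) L with hS
  have hS1 : 1 ≤ S := le_min (by linarith) (by linarith)
  have hSL : S ≤ L := min_le_right _ _
  have hSy : S ≤ y / 2 := min_le_left _ _
  have hHb := hH Δ β y L S hΔ0.le hΔs hL4 hΔL hβ.le hy0.le hS1 hSL
  have hVb := vert_bound hΔ0.le hΔs hβ.le hL4 hΔL hS1 hSL hSy
  have hc1 := hfun_contour (S := S) hΔ0.le hΔs hβ.le hy0.le (by linarith)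
  have hc0 := hfun_contour (Δ := 0) (S := S) le_rfl (by norm_num) hβ.le hy0.le (by linarith)
  have hc1' := congrArg Complex.im hc1
  have hc0' := congrArg Complex.im hc0
  rw [Complex.sub_im, vert_im hΔ0.le hΔs (by linarith)] at hc1'
  rw [Complex.sub_im, vert_im le_rfl (by norm_num) (by linarith), bco_zero] at hc0'
  simp only [zero_mul, Real.sin_zero, mul_zero, intervalIntegral.integral_zero, sub_zero] at hc0'
  have hJ0 := Jint_zero hβ.le hy0.le
  rw [hc0'] at hJ0
  set H1 := (∫ u in Ioi (0 : ℝ), hfun Δ β y ((u : ℂ) - S * Complex.I)).im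
  set H0 := (∫ u in Ioi (0 : ℝ), hfun 0 β y ((u : ℂ) - S * Complex.I)).im
  set V := ∫ s in (0 : ℝ)..S, s * Real.exp (-(s * y)) * (Real.exp (aco Δ β * s ^ (2 - Δ)) *
      Real.sin (bco Δ β * s ^ (2 - Δ)))
  set p := y ^ (Δ - 4) with hp
  have hp0 : 0 < p := by positivity
  set N := normalDensity y with hN
  have hNpos : 0 < N := by rw [hN, normalDensity]; positivity
  obtain ⟨b0, b1⟩ := bco_bounds hΔ0.le hΔs hβ.le
  have hpi := Real.pi_pos
  have hpi1 : 1 / Real.pi ≤ 1 := by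
    rw [div_le_one hpi]; linarith [Real.pi_gt_three]
  have hpi0 : 0 ≤ 1 / Real.pi := by positivity
  -- third term
  have T3 : |1 / Real.pi * (bco Δ β * (p * Real.Gamma (4 - Δ))) - 3 * (1 + β) * Δ * p| ≤
      ε * ((1 + β) * Δ * p) := by
    have h := hlim (show Δ ∈ Ioi 0 from hΔ0) (by rw [Real.dist_eq, sub_zero, abs_of_pos hΔ0]; exact hΔ1)
    rw [Real.dist_eq] at h
    have e : 1 / Real.pi * (bco Δ β * (p * Real.Gamma (4 - Δ))) - 3 * (1 + β) * Δ * p =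
        ((1 + β) * Δ * p) * (Real.sin (Real.pi * Δ / 2) / (Real.pi * Δ) * Real.Gamma (4 - Δ) - 3) := by
      rw [bco]; field_simp
    rw [e, abs_mul, abs_of_nonneg (by positivity), mul_comm ε]
    gcongr
  -- second term
  have T2 : |1 / Real.pi * (V - bco Δ β * (p * Real.Gamma (4 - Δ)))| ≤ ε * ((1 + β) * Δ * p) := by
    rw [abs_mul, abs_of_nonneg hpi0]
    have hyy : 4 * (81 * 64 * 120) / y ≤ ε * (1 + β) := by
      rw [div_le_iff₀ hy0]
      have : 4 * (81 * 64 * 120) / (ε * (1 + β)) ≤ y := by linarith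
      rw [div_le_iff₀ (by positivity)] at this
      linarith
    calc _ ≤ 1 * (bco Δ β * (81 * 64 * 120) * (p / y)) := by gcongr
      _ ≤ 1 * ((4 * Δ) * (81 * 64 * 120) * (p / y)) := by gcongr
      _ = (4 * (81 * 64 * 120) / y) * (Δ * p) := by ring
      _ ≤ (ε * (1 + β)) * (Δ * p) := by gcongr
      _ = _ := by ring
  -- first term
  have hLM1 : 8 * C / ε ≤ L := by
    have : 0 ≤ C * K / (ε * (1 + β)) := by positivity
    linarith
  have hLM2 : C * K / (ε * (1 + β)) ≤ L := by
    have : 0 ≤ 8 * C / ε := by positivity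
    linarith
  have T1 : |1 / Real.pi * (H1 - H0)| ≤ ε * (y / 2 * N) + ε * ((1 + β) * Δ * p) := by
    rw [abs_mul, abs_of_nonneg hpi0]
    have h1 : 1 / Real.pi * |H1 - H0| ≤
        1 * (C / L ^ 2 * (Real.exp (-(S * y)) * Real.exp (S ^ 2) * (S + 1))) := by gcongr
    refine h1.trans ?_
    rw [one_mul]
    rcases le_total (y / 2) L with h | h
    · have hSe : S = y / 2 := min_eq_left h
      rw [hSe]
      have ee : Real.exp (-(y / 2 * y)) * Real.exp ((y / 2) ^ 2) = Real.exp (-(y ^ 2) / 4) := by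
        rw [← Real.exp_add]; congr 1; ring
      rw [ee]
      have hNl : y * Real.exp (-(y ^ 2) / 4) ≤ 8 * (y / 2 * N) := by
        rw [hN, normalDensity]
        have hsq : Real.sqrt Real.pi ≤ 2 := by
          rw [Real.sqrt_le_left (by norm_num)]; linarith [Real.pi_lt_four]
        have hsq0 : 0 < Real.sqrt Real.pi := Real.sqrt_pos.2 hpi
        have : 1 / 4 ≤ 1 / (2 * Real.sqrt Real.pi) :=
          one_div_le_one_div_of_le (by positivity) (by linarith)
        calc y * Real.exp (-(y ^ 2) / 4) = 8 * (y / 2 * (1 / 4 * Real.exp (-(y ^ 2) / 4))) := by ring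
          _ ≤ _ := by gcongr
      have hCL : C / L ^ 2 * 8 ≤ ε := by
        rw [div_mul_eq_mul_div, div_le_iff₀ (by positivity)]
        rw [div_le_iff₀ hε] at hLM1
        have hLL : L ≤ L ^ 2 := by
          calc L = L * 1 := (mul_one L).symm
            _ ≤ L * L := by gcongr; linarith only [hL4]
            _ = L ^ 2 := by ring
        calc C * 8 ≤ L * ε := by linarith only [hLM1]
          _ ≤ L ^ 2 * ε := by gcongr
          _ = ε * L ^ 2 := by ring
      calc C / L ^ 2 * (Real.exp (-(y ^ 2) / 4) * (y / 2 + 1))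
          ≤ C / L ^ 2 * (Real.exp (-(y ^ 2) / 4) * y) := by gcongr; linarith
        _ = C / L ^ 2 * (y * Real.exp (-(y ^ 2) / 4)) := by ring
        _ ≤ C / L ^ 2 * (8 * (y / 2 * N)) := by gcongr
        _ = (C / L ^ 2 * 8) * (y / 2 * N) := by ring
        _ ≤ ε * (y / 2 * N) := by gcongr
        _ ≤ _ := by
          have : 0 ≤ ε * ((1 + β) * Δ * p) := by positivity
          linarith
    · have hSe : S = L := min_eq_right h
      rw [hSe]
      have ee : Real.exp (-(L * y)) * Real.exp (L ^ 2) ≤ Real.exp (-(L * y / 2)) := by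
        rw [← Real.exp_add]; apply Real.exp_le_exp.2; nlinarith only [h, hLpos]
      have hyp : y ^ (-4 : ℝ) ≤ p := Real.rpow_le_rpow_of_exponent_le (by linarith) (by linarith)
      have hyp' : 1 / y ^ 4 ≤ p := by
        refine le_trans (le_of_eq ?_) hyp
        rw [Real.rpow_neg hy0.le, one_div]
        norm_cast
      have hexp : Real.exp (-(L * y / 2)) ≤ K / L * (Δ * p) := by
        have hf := Real.pow_div_factorial_le_exp (L * y / 2) (by positivity) 9
        have hfac : ((Nat.factorial 9 : ℕ) : ℝ) = 362880 := by norm_num [Nat.factorial]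
        rw [hfac] at hf
        have hlow : L ^ 13 * y ^ 4 * L / K ≤ (L * y / 2) ^ 9 / 362880 := by
          have h5 : L ^ 5 ≤ y ^ 5 := by gcongr; linarith
          calc L ^ 13 * y ^ 4 * L / K = L ^ 9 * y ^ 4 * L ^ 5 / K := by ring
            _ ≤ L ^ 9 * y ^ 4 * y ^ 5 / K := by gcongr
            _ = _ := by rw [hK]; ring
        have hall := hlow.trans hf
        have hpos : 0 < L ^ 13 * y ^ 4 * L / K := by positivity
        rw [Real.exp_neg]
        calc (Real.exp (L * y / 2))⁻¹ ≤ (L ^ 13 * y ^ 4 * L / K)⁻¹ := inv_anti₀ hpos hall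
          _ = K / L * (1 / L ^ 12 * (1 / y ^ 4)) / L := by field_simp
          _ = K / L * (Δ * (1 / y ^ 4)) / L := by
            have : 1 / L ^ 12 = Δ := by rw [hL12]; field_simp
            rw [this]
          _ ≤ K / L * (Δ * (1 / y ^ 4)) / 1 := by
            gcongr
            linarith
          _ ≤ K / L * (Δ * p) := by rw [div_one]; gcongr
      have hCL : C / L ^ 2 * (L + 1) ≤ C := by
        rw [div_mul_eq_mul_div, div_le_iff₀ (by positivity)]
        have : L + 1 ≤ L ^ 2 := by nlinarith only [hL4]
        gcongr
      have hCK : C * (K / L) ≤ ε * (1 + β) := by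
        rw [div_le_iff₀ (by positivity)] at hLM2
        rw [mul_div_assoc', div_le_iff₀ hLpos]
        linarith
      calc C / L ^ 2 * (Real.exp (-(L * y)) * Real.exp (L ^ 2) * (L + 1))
          ≤ C / L ^ 2 * (Real.exp (-(L * y / 2)) * (L + 1)) := by gcongr
        _ = (C / L ^ 2 * (L + 1)) * Real.exp (-(L * y / 2)) := by ring
        _ ≤ C * (K / L * (Δ * p)) := by gcongr
        _ = (C * (K / L)) * (Δ * p) := by ring
        _ ≤ (ε * (1 + β)) * (Δ * p) := by gcongr
        _ = ε * ((1 + β) * Δ * p) := by ring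
        _ ≤ _ := by
          have : 0 ≤ ε * (y / 2 * N) := by positivity
          linarith
  have hdec : (1 / Real.pi) * (Jint Δ β y).im - (-(y / 2) * N + -3 * (1 + β) * Δ * p) =
      1 / Real.pi * (H1 - H0) - 1 / Real.pi * (V - bco Δ β * (p * Real.Gamma (4 - Δ))) -
      (1 / Real.pi * (bco Δ β * (p * Real.Gamma (4 - Δ))) - 3 * (1 + β) * Δ * p) := by
    rw [hc1']
    linear_combination hJ0
  rw [hdec]
  calc _ ≤ |1 / Real.pi * (H1 - H0)| + |1 / Real.pi * (V - bco Δ β * (p * Real.Gamma (4 - Δ)))| +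
      |1 / Real.pi * (bco Δ β * (p * Real.Gamma (4 - Δ))) - 3 * (1 + β) * Δ * p| := by
        refine (abs_sub _ _).trans ?_
        gcongr
        exact abs_sub _ _
    _ ≤ (ε * (y / 2 * N) + ε * ((1 + β) * Δ * p)) + ε * ((1 + β) * Δ * p) +
        ε * ((1 + β) * Δ * p) := by gcongr
    _ = _ := by ring

lemma zetaPar_eq (Δ β : ℝ) : zetaPar (2 - Δ) β = β * Real.tan (Real.pi * Δ / 2) := by
  have : Real.pi * (2 - Δ) / 2 = Real.pi - Real.pi * Δ / 2 := by ring
  rw [zetaPar, this, Real.tan_pi_sub]; ring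

lemma integrand_eq (Δ β x : ℝ) {t : ℝ} (ht : 0 < t) :
    Complex.exp (-(Complex.I * (t : ℂ) * (x : ℂ))) *
        Complex.exp (-(((t ^ (2 - Δ) : ℝ) : ℂ)) *
          (1 + Complex.I * (β : ℂ) * ((Real.tan (Real.pi * (2 - Δ) / 2) : ℝ) : ℂ) *
            (((t ^ (1 - (2 - Δ)) : ℝ) : ℂ) - 1))) =
    Complex.exp (-(Complex.I * (t : ℂ) * ((x - zetaPar (2 - Δ) β : ℝ) : ℂ))) *
      Complex.exp (-(ccst Δ β * ((t ^ (2 - Δ) : ℝ) : ℂ))) := by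
  have htan : Real.tan (Real.pi * (2 - Δ) / 2) = -Real.tan (Real.pi * Δ / 2) := by
    have : Real.pi * (2 - Δ) / 2 = Real.pi - Real.pi * Δ / 2 := by ring
    rw [this, Real.tan_pi_sub]
  have hpow : ((t ^ (2 - Δ) : ℝ) : ℂ) * ((t ^ (1 - (2 - Δ)) : ℝ) : ℂ) = (t : ℂ) := by
    rw [← Complex.ofReal_mul, ← Real.rpow_add ht]
    simp
  rw [← Complex.exp_add, ← Complex.exp_add, zetaPar_eq, htan, ccst]
  congr 1
  generalize Real.tan (Real.pi * Δ / 2) = T at *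
  push_cast at hpow ⊢
  linear_combination (Complex.I * β * T) * hpow

lemma stable_deriv {Δ β x : ℝ} (h0 : 0 < Δ) (h1 : Δ ≤ 1 / 100) :
    deriv (stableDensity (2 - Δ) β) x =
      (1 / Real.pi) * (Jint Δ β (x - zetaPar (2 - Δ) β)).im := by
  set ζ := zetaPar (2 - Δ) β with hζ
  set F : ℝ → ℝ → ℂ := fun x t =>
    Complex.exp (-(Complex.I * (t : ℂ) * ((x - ζ : ℝ) : ℂ))) *
      Complex.exp (-(ccst Δ β * ((t ^ (2 - Δ) : ℝ) : ℂ))) with hF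
  set F' : ℝ → ℝ → ℂ := fun x t => -(Complex.I * (t : ℂ)) * F x t with hF'
  have hcp : Continuous fun t : ℝ => t ^ (2 - Δ) := Real.continuous_rpow_const (by linarith)
  have hcF : ∀ x, Continuous (F x) := by
    intro x
    simp only [hF]
    fun_prop
  have hcF' : ∀ x, Continuous (F' x) := by
    intro x
    have := hcF x
    simp only [hF']
    fun_prop
  have hnorm : ∀ x t : ℝ, ‖F x t‖ = Real.exp (-t ^ (2 - Δ)) := by
    intro x t
    simp only [hF]
    rw [norm_mul, Complex.norm_exp, Complex.norm_exp]
    have e1 : (-(Complex.I * (t : ℂ) * ((x - ζ : ℝ) : ℂ))).re = 0 := by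
      rw [mul_assoc, ← Complex.ofReal_mul]
      simp [-Complex.ofReal_mul]
    have e2 : (-(ccst Δ β * ((t ^ (2 - Δ) : ℝ) : ℂ))).re = -t ^ (2 - Δ) := by
      rw [Complex.neg_re, Complex.re_mul_ofReal, ccst_re, one_mul]
    rw [e1, e2, Real.exp_zero, one_mul]
  have hi0 : IntegrableOn (fun t : ℝ => Real.exp (-t ^ (2 - Δ))) (Ioi 0) := by
    have := integrableOn_rpow_mul_exp_neg_mul_rpow (p := 2 - Δ) (s := 0) (b := 1) (by norm_num)
      (by linarith) one_pos
    simpa using this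
  have hi1 : IntegrableOn (fun t : ℝ => t * Real.exp (-t ^ (2 - Δ))) (Ioi 0) := by
    have := integrableOn_rpow_mul_exp_neg_mul_rpow (p := 2 - Δ) (s := 1) (b := 1) (by norm_num)
      (by linarith) one_pos
    simpa using this
  have hd := (hasDerivAt_integral_of_dominated_loc_of_deriv_le (μ := volume.restrict (Ioi (0:ℝ)))
    (F := F) (F' := F') (x₀ := x) (s := univ)
    (bound := fun t => t * Real.exp (-t ^ (2 - Δ))) univ_mem
    (Eventually.of_forall fun x => (hcF x).aestronglyMeasurable)
    ?_ (hcF' x).aestronglyMeasurable ?_ hi1 ?_).2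
  · have hJ : (∫ t in Ioi (0:ℝ), F' x t) = -Complex.I * Jint Δ β (x - ζ) := by
      rw [Jint, ← MeasureTheory.integral_const_mul]
      refine setIntegral_congr_fun measurableSet_Ioi fun t ht => ?_
      have ht0 : (0:ℝ) < t := ht
      simp only [hF', hF, hfun]
      rw [Complex.ofReal_cpow ht0.le]
      ring
    rw [hJ] at hd
    have hre := (Complex.reCLM.hasFDerivAt.comp_hasDerivAt x hd).const_mul (1 / Real.pi)
    have hfun_eq : stableDensity (2 - Δ) β = fun x => 1 / Real.pi *
        (Complex.reCLM (∫ t in Ioi (0:ℝ), F x t)) := by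
      funext x
      rw [stableDensity, Complex.reCLM_apply]
      congr 2
      refine setIntegral_congr_fun measurableSet_Ioi fun t ht => ?_
      exact integrand_eq Δ β x ht
    rw [hfun_eq]
    refine hre.deriv.trans ?_
    simp
  · refine Integrable.mono' hi0 (hcF x).aestronglyMeasurable ?_
    exact Eventually.of_forall fun t => (hnorm x t).le
  · refine (ae_restrict_mem measurableSet_Ioi).mono fun t ht x _ => ?_
    have ht0 : (0:ℝ) < t := ht
    simp only [hF']
    rw [norm_mul, hnorm, norm_neg, norm_mul, Complex.norm_I, one_mul, Complex.norm_real,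
      Real.norm_of_nonneg ht0.le]
  · refine Eventually.of_forall fun t x _ => ?_
    simp only [hF', hF]
    have a1 : HasDerivAt (fun x : ℝ => ((x - ζ : ℝ) : ℂ)) 1 x :=
      ((hasDerivAt_id x).sub_const ζ).ofReal_comp
    have a2 := ((a1.const_mul (Complex.I * (t:ℂ))).neg.cexp).mul_const
      (Complex.exp (-(ccst Δ β * ((t ^ (2 - Δ) : ℝ) : ℂ))))
    refine HasDerivAt.congr_deriv a2 ?_
    simp only [Pi.neg_apply]
    ring

lemma Jint_symm (Δ β y : ℝ) : (Jint Δ β y).im = -(Jint Δ (-β) (-y)).im := by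
  have h : Jint Δ (-β) (-y) = (starRingEnd ℂ) (Jint Δ β y) := by
    rw [Jint, Jint, ← integral_conj]
    refine setIntegral_congr_fun measurableSet_Ioi fun t ht => ?_
    have ht0 : (0:ℝ) < t := ht
    have hc : ccst Δ (-β) = (starRingEnd ℂ) (ccst Δ β) := by
      simp [ccst, -Complex.ofReal_tan]
    simp only [hfun]
    rw [← Complex.ofReal_cpow ht0.le, hc]
    simp [← Complex.exp_conj]
  rw [h, Complex.conj_im, neg_neg]

lemma ratio_close {f g ε : ℝ} (hg : g ≠ 0) (hε : 0 < ε) (h : |f - g| ≤ ε / 2 * |g|) :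
    |f / g - 1| < ε := by
  have hg' : 0 < |g| := abs_pos.2 hg
  have : f / g - 1 = (f - g) / g := by field_simp
  rw [this, abs_div, div_lt_iff₀ hg']
  nlinarith

lemma normalDensity_pos (y : ℝ) : 0 < normalDensity y := by
  rw [normalDensity]; positivity

lemma normalDensity_neg (y : ℝ) : normalDensity (-y) = normalDensity y := by
  simp [normalDensity]

lemma first_part {β ε : ℝ} (hβ : |β| < 1) (hε : 0 < ε) : ∃ Δ₀ > (0 : ℝ), Δ₀ ≤ 1 / 100 ∧
    ∃ Y > (0 : ℝ), ∀ Δ : ℝ, 0 < Δ → Δ < Δ₀ → ∀ x : ℝ, Y ≤ |x - zetaPar (2 - Δ) β| →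
        |deriv (stableDensity (2 - Δ) β) x / gApprox' (2 - Δ) β x - 1| < ε := by
  obtain ⟨D1, hD1, hD1', Y1, hY1, H1⟩ := core hβ (half_pos hε)
  obtain ⟨D2, hD2, hD2', Y2, hY2, H2⟩ := core (β := -β) (by rwa [abs_neg]) (half_pos hε)
  have hb := abs_lt.1 hβ
  refine ⟨min D1 D2, lt_min hD1 hD2, (min_le_left _ _).trans hD1', max Y1 Y2,
    lt_max_of_lt_left hY1, ?_⟩
  intro Δ h0 hlt x hx
  have hΔ1 : Δ < D1 := hlt.trans_le (min_le_left _ _)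
  have hΔ2 : Δ < D2 := hlt.trans_le (min_le_right _ _)
  rw [stable_deriv h0 (by linarith)]
  rw [gApprox', F1', F2']
  generalize x - zetaPar (2 - Δ) β = y at *
  have hy0 : 0 < |y| := hY1.trans_le ((le_max_left _ _).trans hx)
  rcases lt_or_gt_of_ne (abs_pos.1 hy0) with hy | hy
  · have hay : |y| = -y := abs_of_neg hy
    rw [Real.sign_of_neg hy, hay]
    rw [hay] at hx
    have h := H2 Δ h0 hΔ2 (-y) ((le_max_right _ _).trans hx)
    rw [normalDensity_neg] at h
    rw [Jint_symm]
    have e1 : 2 - (2 - Δ) = Δ := by ring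
    rw [e1]
    have hN := normalDensity_pos y
    have hp : 0 < (-y) ^ (Δ - 4) := Real.rpow_pos_of_pos (by linarith) _
    have hb1 : 0 < 1 - β := by linarith
    have hpos : 0 < -(y / 2) * normalDensity y + -3 * (1 + β * -1) * Δ * -1 * (-y) ^ (Δ - 4) := by
      have t1 : 0 < (-y) * normalDensity y := mul_pos (by linarith) hN
      have t2 : 0 < (1 - β) * Δ * (-y) ^ (Δ - 4) := by positivity
      nlinarith
    refine ratio_close hpos.ne' hε ?_
    rw [abs_of_pos hpos]
    rw [← abs_neg]
    refine le_trans (le_of_eq ?_) (h.trans (le_of_eq ?_))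
    · congr 1; ring
    · ring
  · have hay : |y| = y := abs_of_pos hy
    rw [Real.sign_of_pos hy, hay]
    rw [hay] at hx
    have h := H1 Δ h0 hΔ1 y ((le_max_left _ _).trans hx)
    have e1 : 2 - (2 - Δ) = Δ := by ring
    rw [e1]
    have hN := normalDensity_pos y
    have hp : 0 < y ^ (Δ - 4) := Real.rpow_pos_of_pos hy _
    have hb1 : 0 < 1 + β := by linarith
    have hneg : -(y / 2) * normalDensity y + -3 * (1 + β * 1) * Δ * 1 * y ^ (Δ - 4) < 0 := by
      have t1 : 0 < y * normalDensity y := mul_pos hy hN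
      have t2 : 0 < (1 + β) * Δ * y ^ (Δ - 4) := by positivity
      nlinarith
    refine ratio_close hneg.ne hε ?_
    rw [abs_of_neg hneg]
    refine le_trans (le_of_eq ?_) (h.trans (le_of_eq ?_))
    · congr 1; ring
    · ring

lemma ratio_sub_one {a b : ℝ} (ha : a ≠ 0) : |(a + b) / a - 1| = |b| / |a| := by
  have : (a + b) / a - 1 = b / a := by field_simp; ring
  rw [this, abs_div]

lemma F1'_abs (α β x : ℝ) : |F1' α β x| = |x - zetaPar α β| / 2 * normalDensity (x - zetaPar α β) := by
  rw [F1', abs_mul, abs_neg, abs_div, abs_two, abs_of_pos (normalDensity_pos _)]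

lemma F2'_abs {Δ β x : ℝ} (h0 : 0 < Δ) (hβ : |β| < 1) (hy : x - zetaPar (2 - Δ) β ≠ 0) :
    3 * (1 - |β|) * Δ * |x - zetaPar (2 - Δ) β| ^ (Δ - 4) ≤ |F2' (2 - Δ) β x| ∧
    |F2' (2 - Δ) β x| ≤ 6 * Δ * |x - zetaPar (2 - Δ) β| ^ (Δ - 4) := by
  rw [F2']
  have e1 : 2 - (2 - Δ) = Δ := by ring
  rw [e1]
  generalize x - zetaPar (2 - Δ) β = y at *
  have hs : |Real.sign y| = 1 := by
    rcases lt_or_gt_of_ne hy with h | h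
    · rw [Real.sign_of_neg h]; norm_num
    · rw [Real.sign_of_pos h]; norm_num
  have hp : 0 < |y| ^ (Δ - 4) := Real.rpow_pos_of_pos (abs_pos.2 hy) _
  have hbs : |β * Real.sign y| = |β| := by rw [abs_mul, hs, mul_one]
  have h1 := abs_le.1 hbs.le
  have h2 : 0 < 1 + β * Real.sign y := by linarith
  rw [abs_mul, abs_mul, abs_mul, abs_mul, hs, abs_of_pos hp, abs_of_pos h0, abs_of_pos h2, mul_one]
  have h3 : |(-3 : ℝ)| = 3 := by norm_num
  rw [h3]
  constructor
  · gcongr; linarith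
  · gcongr; linarith

lemma exp_log_bound {Δ k : ℝ} (h0 : 0 < Δ) : Real.exp (-(k * Real.log (1 / Δ))) = Δ ^ k := by
  rw [Real.rpow_def_of_pos h0, one_div, Real.log_inv]
  congr 1; ring

lemma near_ratio {Δ β δ x : ℝ} (h0 : 0 < Δ) (h1 : Δ ≤ 1 / 100) (hβ : |β| < 1)
    (hδ2 : δ < 2) (hy : 1 ≤ |x - zetaPar (2 - Δ) β|)
    (hle : |x - zetaPar (2 - Δ) β| ≤ (2 - δ) * Real.sqrt (Real.log (1 / Δ))) :
    |gApprox' (2 - Δ) β x / F1' (2 - Δ) β x - 1| ≤ 48 * Δ ^ (δ - δ ^ 2 / 4) := by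
  have hy0 : x - zetaPar (2 - Δ) β ≠ 0 := by
    intro h; rw [h] at hy; simp at hy; linarith
  have hlog : 0 ≤ Real.log (1 / Δ) := Real.log_nonneg (by rw [le_div_iff₀ h0]; linarith)
  have hF1 := F1'_abs (2 - Δ) β x
  have hF2 := (F2'_abs h0 hβ hy0).2
  have hne : F1' (2 - Δ) β x ≠ 0 := by
    rw [← abs_pos, hF1]
    have := normalDensity_pos (x - zetaPar (2 - Δ) β)
    positivity
  rw [gApprox', ratio_sub_one hne, hF1]
  generalize x - zetaPar (2 - Δ) β = y at *
  have hp1 : |y| ^ (Δ - 4) ≤ 1 := Real.rpow_le_one_of_one_le_of_nonpos hy (by linarith)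
  have hsq : y ^ 2 ≤ (2 - δ) ^ 2 * Real.log (1 / Δ) := by
    have : |y| ^ 2 ≤ ((2 - δ) * Real.sqrt (Real.log (1 / Δ))) ^ 2 := by gcongr
    rwa [sq_abs, mul_pow, Real.sq_sqrt hlog] at this
  have hN : 1 / 4 * Δ ^ (1 - δ + δ ^ 2 / 4) ≤ normalDensity y := by
    rw [normalDensity]
    have hs2 : Real.sqrt Real.pi ≤ 2 := by
      rw [Real.sqrt_le_left (by norm_num)]; linarith [Real.pi_lt_four]
    have hsq0 : 0 < Real.sqrt Real.pi := Real.sqrt_pos.2 Real.pi_pos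
    gcongr
    · linarith
    · rw [← exp_log_bound h0]
      apply Real.exp_le_exp.2
      nlinarith
  have hD : 0 < Δ ^ (1 - δ + δ ^ 2 / 4) := by positivity
  rw [div_le_iff₀ (by have := normalDensity_pos y; positivity)]
  have hmul : Δ ^ (δ - δ ^ 2 / 4) * Δ ^ (1 - δ + δ ^ 2 / 4) = Δ := by
    rw [← Real.rpow_add h0]
    rw [show δ - δ ^ 2 / 4 + (1 - δ + δ ^ 2 / 4) = 1 by ring, Real.rpow_one]
  calc |F2' (2 - Δ) β x| ≤ 6 * Δ * 1 := hF2.trans (by gcongr)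
    _ = 48 * Δ ^ (δ - δ ^ 2 / 4) * (1 / 2 * (1 / 4 * Δ ^ (1 - δ + δ ^ 2 / 4))) := by
      linear_combination -6 * hmul
    _ ≤ _ := by gcongr

lemma far_ratio {Δ β δ x : ℝ} (h0 : 0 < Δ) (h1 : Δ ≤ 1 / 100) (hβ : |β| < 1)
    (hδ : 0 < δ) (hy : 1 ≤ |x - zetaPar (2 - Δ) β|)
    (hle : (2 + δ) * Real.sqrt (Real.log (1 / Δ)) ≤ |x - zetaPar (2 - Δ) β|) :
    |gApprox' (2 - Δ) β x / F2' (2 - Δ) β x - 1| ≤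
      (384 / ((1 - 1 / (1 + δ / 2)) / 2) ^ 3) / (1 - |β|) * Δ ^ (3 * δ / 4 + δ ^ 2 / 8) := by
  have hy0 : x - zetaPar (2 - Δ) β ≠ 0 := by
    intro h; rw [h] at hy; simp at hy; linarith
  have hlog : 0 ≤ Real.log (1 / Δ) := Real.log_nonneg (by rw [le_div_iff₀ h0]; linarith)
  have hF1 := F1'_abs (2 - Δ) β x
  have hF2 := (F2'_abs h0 hβ hy0).1
  have hm : 0 < 1 - |β| := by linarith
  have hpow : 0 < |x - zetaPar (2 - Δ) β| ^ (Δ - 4) := Real.rpow_pos_of_pos (by linarith) _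
  have hF2pos : 0 < |F2' (2 - Δ) β x| := lt_of_lt_of_le (by positivity) hF2
  have hne : F2' (2 - Δ) β x ≠ 0 := abs_pos.1 hF2pos
  rw [gApprox', add_comm, ratio_sub_one hne, hF1, div_le_iff₀ hF2pos]
  generalize x - zetaPar (2 - Δ) β = y at *
  set θ : ℝ := (1 - 1 / (1 + δ / 2)) / 2 with hθ
  have hθ0 : 0 < θ := by
    have : 1 / (1 + δ / 2) < 1 := by rw [div_lt_one (by positivity)]; linarith
    rw [hθ]; linarith
  have hθ1 : (1 - θ) * (1 + δ / 2) ^ 2 = 1 + (3 * δ / 4 + δ ^ 2 / 8) := by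
    rw [hθ]; field_simp; ring
  have hθ2 : 0 ≤ 1 - θ := by
    have : 0 ≤ 1 / (1 + δ / 2) := by positivity
    rw [hθ]; linarith
  have hsq : (2 + δ) ^ 2 * Real.log (1 / Δ) ≤ y ^ 2 := by
    have : ((2 + δ) * Real.sqrt (Real.log (1 / Δ))) ^ 2 ≤ |y| ^ 2 := by gcongr
    rwa [sq_abs, mul_pow, Real.sq_sqrt hlog] at this
  have hexp1 : Real.exp (-((1 - θ) * (y ^ 2 / 4))) ≤ Δ * Δ ^ (3 * δ / 4 + δ ^ 2 / 8) := by
    have : Δ * Δ ^ (3 * δ / 4 + δ ^ 2 / 8) = Δ ^ (1 + (3 * δ / 4 + δ ^ 2 / 8)) := by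
      rw [Real.rpow_add h0 1, Real.rpow_one]
    rw [this, ← exp_log_bound h0, ← hθ1]
    apply Real.exp_le_exp.2
    have : (1 - θ) * ((2 + δ) ^ 2 * Real.log (1 / Δ)) ≤ (1 - θ) * y ^ 2 := by gcongr
    nlinarith
  have hexp2 : |y| ^ 5 * Real.exp (-(θ * (y ^ 2 / 4))) ≤ 384 / θ ^ 3 := by
    have hf := Real.pow_div_factorial_le_exp (θ * (y ^ 2 / 4)) (by positivity) 3
    have hfac : ((Nat.factorial 3 : ℕ) : ℝ) = 6 := by norm_num [Nat.factorial]
    rw [hfac] at hf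
    rw [Real.exp_neg, ← div_eq_mul_inv, div_le_iff₀ (Real.exp_pos _)]
    calc |y| ^ 5 ≤ |y| ^ 6 := pow_le_pow_right₀ hy (by norm_num)
      _ = (y ^ 2) ^ 3 := by rw [← sq_abs y]; ring
      _ = 384 / θ ^ 3 * ((θ * (y ^ 2 / 4)) ^ 3 / 6) := by field_simp; norm_num
      _ ≤ _ := by gcongr
  have hN : normalDensity y ≤ Real.exp (-(θ * (y ^ 2 / 4))) * Real.exp (-((1 - θ) * (y ^ 2 / 4))) := by
    rw [normalDensity, ← Real.exp_add]
    have hs1 : 1 ≤ Real.sqrt Real.pi := by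
      rw [Real.one_le_sqrt]; linarith [Real.pi_gt_three]
    have : 1 / (2 * Real.sqrt Real.pi) ≤ 1 := by
      rw [div_le_one (by positivity)]; linarith
    calc _ ≤ 1 * Real.exp (-(y ^ 2) / 4) := by gcongr
      _ = _ := by rw [one_mul]; congr 1; ring
  have hp4 : 1 / |y| ^ 4 ≤ |y| ^ (Δ - 4) := by
    have : |y| ^ (-4 : ℝ) ≤ |y| ^ (Δ - 4) := Real.rpow_le_rpow_of_exponent_le hy (by linarith)
    refine le_trans (le_of_eq ?_) this
    rw [Real.rpow_neg (abs_nonneg y), one_div]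
    norm_cast
  have hya : 0 < |y| := by linarith
  set P := Δ ^ (3 * δ / 4 + δ ^ 2 / 8) with hP
  have hP0 : 0 < P := by positivity
  calc |y| / 2 * normalDensity y
      ≤ |y| * (Real.exp (-(θ * (y ^ 2 / 4))) * Real.exp (-((1 - θ) * (y ^ 2 / 4)))) := by
        have : 0 < normalDensity y := normalDensity_pos y
        gcongr
        linarith
    _ = (|y| ^ 5 * Real.exp (-(θ * (y ^ 2 / 4)))) * Real.exp (-((1 - θ) * (y ^ 2 / 4))) *
        (1 / |y| ^ 4) := by field_simp
    _ ≤ (384 / θ ^ 3) * (Δ * P) * |y| ^ (Δ - 4) := by gcongr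
    _ = 384 / θ ^ 3 / (1 - |β|) * P * (1 * (1 - |β|) * Δ * |y| ^ (Δ - 4)) := by
      field_simp
    _ ≤ 384 / θ ^ 3 / (1 - |β|) * P * (3 * (1 - |β|) * Δ * |y| ^ (Δ - 4)) := by
      gcongr; norm_num
    _ ≤ _ := by gcongr

lemma rpow_ratio_tendsto (A : ℝ) {e d : ℝ} (h : d < e) :
    Tendsto (fun Δ : ℝ => A * |Δ| ^ e / Δ ^ d) (𝓝[>] 0) (𝓝 0) := by
  have h1 : Tendsto (fun Δ : ℝ => A * Δ ^ (e - d)) (𝓝 0) (𝓝 (A * 0 ^ (e - d))) :=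
    ((Real.continuousAt_rpow_const 0 (e - d) (Or.inr (by linarith))).tendsto).const_mul A
  rw [Real.zero_rpow (by linarith), mul_zero] at h1
  refine (h1.mono_left nhdsWithin_le_nhds).congr' ?_
  filter_upwards [self_mem_nhdsWithin] with Δ hΔ
  have h0 : (0:ℝ) < Δ := hΔ
  rw [abs_of_pos h0, Real.rpow_sub h0]; ring

theorem density_derivative_ratio_approximation (β : ℝ) (hβ : β ∈ Set.Ioo (-1 : ℝ) 1)
    (ε : ℝ) (hε : 0 < ε) :
    ∃ Δ₀ > (0 : ℝ), ∃ x₀ > (0 : ℝ),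
      (∀ Δ : ℝ, 0 < Δ → Δ < Δ₀ → ∀ x : ℝ, x₀ < |x| →
        |deriv (stableDensity (2 - Δ) β) x / gApprox' (2 - Δ) β x - 1| < ε) ∧
      (∀ δ : ℝ, 0 < δ → ∃ r : ℝ → ℝ, (∀ Δ : ℝ, 0 ≤ r Δ) ∧
        Filter.Tendsto (fun Δ : ℝ => r Δ / Δ ^ (δ / 2)) (nhdsWithin 0 (Set.Ioi 0)) (nhds 0) ∧
        ∀ Δ : ℝ, 0 < Δ → Δ < Δ₀ → ∀ x : ℝ, x₀ < |x| →
          (|x - zetaPar (2 - Δ) β| ≤ (2 - δ) * Real.sqrt (Real.log (1 / Δ)) →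
            |gApprox' (2 - Δ) β x / F1' (2 - Δ) β x - 1| ≤ r Δ) ∧
          ((2 + δ) * Real.sqrt (Real.log (1 / Δ)) ≤ |x - zetaPar (2 - Δ) β| →
            |gApprox' (2 - Δ) β x / F2' (2 - Δ) β x - 1| ≤ r Δ)) := by
  have hβ' : |β| < 1 := abs_lt.2 hβ
  obtain ⟨D, hD, hD1, Y, hY, H⟩ := first_part hβ' hε
  have hshift : ∀ Δ : ℝ, 0 < Δ → Δ < D → ∀ x : ℝ, Y + 2 < |x| →
      Y + 1 ≤ |x - zetaPar (2 - Δ) β| := by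
    intro Δ h0 h1 x hx
    rw [zetaPar_eq]
    have hbt := abs_bt h0.le (by linarith) hβ'.le
    have := abs_sub_abs_le_abs_sub x (β * Real.tan (Real.pi * Δ / 2))
    linarith
  refine ⟨D, hD, Y + 2, by linarith, ?_, ?_⟩
  · intro Δ h0 h1 x hx
    exact H Δ h0 h1 x (by linarith [hshift Δ h0 h1 x hx])
  · intro δ hδ
    set A : ℝ := (384 / ((1 - 1 / (1 + δ / 2)) / 2) ^ 3) / (1 - |β|) with hA
    have hA0 : 0 ≤ A := by
      have hθ0 : 0 < (1 - 1 / (1 + δ / 2)) / 2 := by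
        have : 1 / (1 + δ / 2) < 1 := by rw [div_lt_one (by positivity)]; linarith
        linarith
      have hm : 0 < 1 - |β| := by linarith
      positivity
    set e1 : ℝ := if δ < 2 then δ - δ ^ 2 / 4 else δ with he1
    have he1' : δ / 2 < e1 := by
      rw [he1]; split_ifs with h
      · nlinarith
      · linarith
    refine ⟨fun Δ => 48 * |Δ| ^ e1 + A * |Δ| ^ (3 * δ / 4 + δ ^ 2 / 8), ?_, ?_, ?_⟩
    · intro Δ; positivity
    · have t := (rpow_ratio_tendsto 48 he1').add
        (rpow_ratio_tendsto A (e := 3 * δ / 4 + δ ^ 2 / 8) (d := δ / 2) (by nlinarith))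
      rw [add_zero] at t
      refine t.congr fun Δ => ?_
      rw [add_div]
    · intro Δ h0 h1 x hx
      have hy := hshift Δ h0 h1 x hx
      have hΔ : Δ ≤ 1 / 100 := by linarith
      have hab : |Δ| = Δ := abs_of_pos h0
      simp only [hab]
      have p1 : 0 ≤ 48 * Δ ^ e1 := by positivity
      have p2 : 0 ≤ A * Δ ^ (3 * δ / 4 + δ ^ 2 / 8) := by positivity
      constructor
      · intro hle
        have hδ2 : δ < 2 := by
          by_contra hcon
          have : (2 - δ) * Real.sqrt (Real.log (1 / Δ)) ≤ 0 :=
            mul_nonpos_of_nonpos_of_nonneg (by linarith) (Real.sqrt_nonneg _)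
          linarith
        have h := near_ratio h0 hΔ hβ' hδ2 (by linarith) hle
        have : e1 = δ - δ ^ 2 / 4 := by rw [he1, if_pos hδ2]
        rw [← this] at h
        linarith
      · intro hle
        have h := far_ratio h0 hΔ hβ' hδ (by linarith) hle
        rw [← hA] at h
        linarith
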